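/- Suppose M is unmixed with dim M = 3 and depth M = 2, and suppose M is not generalized Cohen-Macaulay. Let S be an S_2-ification of M. Then D := S/M is a Cohen-Macaulay module of dimension 1. -/

import Mathlib

open IsLocalRing

universe u

namespace Paper

variable (R : Type u) [CommRing R]

/-- `dim_{R/I} Soc_I(N)` where `Soc_I(N) = (0 :_N I)`. -/
noncomputable def socDim (I : Ideal R) (N : Type u) [AddCommGroup N] [Module R N] : ℕ :=
  Module.finrank (R ⧸ I) (Submodule.torsionBySet R N (I : Set R))

/-- Krull dimension of a module (`⊥` for the zero module). -/
noncomputable def mdim (M : Type u) [AddCommGroup M] [Module R M] : WithBot (WithTop ℕ) :=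
  ringKrullDim (R ⧸ Module.annihilator R M)

/-- The index of reducibility of an ideal `q` on `M`: `dim_k Soc (M/qM)`. -/
noncomputable def ir [IsLocalRing R] (M : Type u) [AddCommGroup M] [Module R M]
    (q : Ideal R) : ℕ :=
  socDim R (maximalIdeal R) (M ⧸ (q • ⊤ : Submodule R M))

/-- `dim_k Soc (H^i_m(M))`. -/
noncomputable def socH [IsLocalRing R] (M : Type u) [AddCommGroup M] [Module R M] (i : ℕ) : ℕ :=
  socDim R (maximalIdeal R) ((localCohomology (maximalIdeal R) i).obj (ModuleCat.of R M))

/-- A system of parameters of `M` (of length `d`): `d` elements of the maximal ideal such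
that the quotient has finite length. -/
def IsSOP [IsLocalRing R] (M : Type u) [AddCommGroup M] [Module R M] (d : ℕ)
    (x : Fin d → R) : Prop :=
  (∀ i, x i ∈ maximalIdeal R) ∧
    IsFiniteLength R (M ⧸ (Ideal.span (Set.range x) • ⊤ : Submodule R M))

/-- A parameter element: an element occurring in some system of parameters of `M`. -/
def IsParamElement [IsLocalRing R] (M : Type u) [AddCommGroup M] [Module R M] (d : ℕ)
    (a : R) : Prop :=
  ∃ x : Fin d → R, IsSOP R M d x ∧ ∃ i, x i = a

/-- The ideal `b(M) = ⋂ Ann (0 :_{M/(x_1,...,x_{i-1})M} x_i)`, the intersection running over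
all systems of parameters `x_1, ..., x_d` of `M`. -/
noncomputable def bIdeal [IsLocalRing R] (M : Type u) [AddCommGroup M] [Module R M]
    (d : ℕ) : Ideal R :=
  ⨅ (x : Fin d → R) (_ : IsSOP R M d x) (i : Fin d),
    Module.annihilator R
      (Submodule.torsionBy R (M ⧸ (Ideal.span (x '' {j | j < i}) • ⊤ : Submodule R M)) (x i))

/-- A C-system of parameters: `x_i ∈ b(M/(x_{i+1},...,x_d)M)^3` for all `i`. -/
def IsCSOP [IsLocalRing R] (M : Type u) [AddCommGroup M] [Module R M] (d : ℕ)
    (x : Fin d → R) : Prop :=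
  IsSOP R M d x ∧ ∀ i : Fin d,
    x i ∈ (bIdeal R (M ⧸ (Ideal.span (x '' {j | i < j}) • ⊤ : Submodule R M)) ((i : ℕ) + 1)) ^ 3

/-- The depth of `M`: the supremum of the lengths of `M`-regular sequences contained in the
maximal ideal. -/
noncomputable def depth [IsLocalRing R] (M : Type u) [AddCommGroup M] [Module R M] :
    WithTop ℕ :=
  sSup {n : WithTop ℕ | ∃ rs : List R, (rs.length : WithTop ℕ) = n ∧
    (∀ r ∈ rs, r ∈ maximalIdeal R) ∧ RingTheory.Sequence.IsRegular M rs}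

/-- `M` is a Cohen-Macaulay module: `depth M = dim M`. -/
def IsCM [IsLocalRing R] (M : Type u) [AddCommGroup M] [Module R M] : Prop :=
  (depth R M : WithBot (WithTop ℕ)) = mdim R M

/-- A Cohen-Macaulay local ring. -/
def IsCMLocalRing (S : Type u) [CommRing S] [IsLocalRing S] : Prop :=
  IsNoetherianRing S ∧ IsCM S S

/-- `R` is a homomorphic image of a Cohen-Macaulay (Noetherian) local ring. -/
def IsQuotientOfCMLocalRing : Prop :=
  ∃ (S : Type u) (_ : CommRing S) (_ : IsLocalRing S),
    IsCMLocalRing S ∧ ∃ f : S →+* R, Function.Surjective f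

/-- The largest submodule of (the submodule) `N` whose dimension is strictly smaller than
that of `N`. -/
noncomputable def uComp (M : Type u) [AddCommGroup M] [Module R M] (N : Submodule R M) :
    Submodule R M :=
  sSup {P : Submodule R M | P ≤ N ∧ mdim R P < mdim R N}

/-- The unmixed component `U_M(0)` of `M`: the largest submodule of dimension `< dim M`. -/
noncomputable def unmixedComp (M : Type u) [AddCommGroup M] [Module R M] : Submodule R M :=
  uComp R M ⊤

/-- The 0-th local cohomology `H^0_m(M)` realized as the submodule of elements annihilated by
some power of the maximal ideal. -/
def H0sub [IsLocalRing R] (M : Type u) [AddCommGroup M] [Module R M] : Submodule R M :=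
  ⨆ n : ℕ, Submodule.torsionBySet R M (((maximalIdeal R) ^ n : Ideal R) : Set R)

/-- The quotient `P/N` of two submodules of `M`. -/
abbrev subQuot (M : Type u) [AddCommGroup M] [Module R M] (P N : Submodule R M) :=
  P ⧸ (Submodule.comap P.subtype N)

/-- `D_0 ⊆ D_1 ⊆ ⋯ ⊆ D_t = M` is the dimension filtration of `M`:
`D_t = M`, each `D_{i-1}` is the largest submodule of `D_i` of strictly smaller dimension,
and `D_0 = H^0_m(M)`. -/
def IsDimFiltration [IsLocalRing R] (M : Type u) [AddCommGroup M] [Module R M]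
    (t : ℕ) (D : Fin (t + 1) → Submodule R M) : Prop :=
  D (Fin.last t) = ⊤ ∧ (∀ i : Fin t, D i.castSucc = uComp R M (D i.succ)) ∧
    D 0 = H0sub R M

/-- `M` is sequentially Cohen-Macaulay: all quotients `D_i/D_{i-1}` of the dimension
filtration are Cohen-Macaulay. -/
def IsSeqCM [IsLocalRing R] (M : Type u) [AddCommGroup M] [Module R M] : Prop :=
  ∃ (t : ℕ) (D : Fin (t + 1) → Submodule R M), IsDimFiltration R M t D ∧
    ∀ i : Fin t, IsCM R (subQuot R M (D i.succ) (D i.castSucc))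

/-- `M` (of dimension `d`) is generalized Cohen-Macaulay: `H^i_m(M)` has finite length
for all `i < d`. -/
def IsGenCM [IsLocalRing R] (M : Type u) [AddCommGroup M] [Module R M] (d : ℕ) : Prop :=
  ∀ i < d, IsFiniteLength R ((localCohomology (maximalIdeal R) i).obj (ModuleCat.of R M))

/-- `α_n(M)`: the minimum of the indices of reducibility of parameter ideals of `M`
contained in `m^n`. -/
noncomputable def alphaN [IsLocalRing R] (M : Type u) [AddCommGroup M] [Module R M]
    (d n : ℕ) : ℕ :=
  sInf {r : ℕ | ∃ x : Fin d → R, IsSOP R M d x ∧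
    Ideal.span (Set.range x) ≤ (maximalIdeal R) ^ n ∧ r = ir R M (Ideal.span (Set.range x))}

/-- The limit value `α(M) = lim_n α_n(M)` (the supremum of the non-decreasing sequence). -/
noncomputable def alphaLim [IsLocalRing R] (M : Type u) [AddCommGroup M] [Module R M]
    (d : ℕ) : ℕ :=
  ⨆ n : ℕ, alphaN R M d (n + 1)

/-- `M` is unmixed: `dim R/p = dim M` for all associated primes `p`. -/
def IsUnmixed (M : Type u) [AddCommGroup M] [Module R M] : Prop :=
  ∀ p ∈ associatedPrimes R M, ringKrullDim (R ⧸ p) = mdim R M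

/-- Serre's condition `(S_2)` for a module. -/
def IsS2 (L : Type u) [AddCommGroup L] [Module R L] : Prop :=
  ∀ p : PrimeSpectrum R, p ∈ Module.support R L →
    min 2 (mdim (Localization.AtPrime p.asIdeal) (LocalizedModule p.asIdeal.primeCompl L)) ≤
      (depth (Localization.AtPrime p.asIdeal) (LocalizedModule p.asIdeal.primeCompl L) :
        WithBot (WithTop ℕ))

/-- `ι : M →ₗ[R] S` exhibits `S` as an `S_2`-ification of `M`. -/
def IsS2ification [IsLocalRing R] (M S : Type u) [AddCommGroup M] [Module R M]
    [AddCommGroup S] [Module R S] (ι : M →ₗ[R] S) : Prop :=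
  Function.Injective ι ∧ Module.Finite R S ∧ IsS2 R S ∧
    ∀ (p : Ideal R) [p.IsPrime], p ≠ maximalIdeal R →
      IsS2 (Localization.AtPrime p) (LocalizedModule p.primeCompl M) →
      Function.Surjective (IsLocalizedModule.map p.primeCompl
        (LocalizedModule.mkLinearMap p.primeCompl M)
        (LocalizedModule.mkLinearMap p.primeCompl S) ι)

end Paper

open Paper IsLocalRing

section Part1

namespace PF

open CategoryTheory CategoryTheory.Abelian

section KE

variable (A : Type u) [CommRing A]

/-- `a` kills `Ext^j(T,N)`. -/
def KE (T N : Type u) [AddCommGroup T] [Module A T] [AddCommGroup N] [Module A N]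
    (j : ℕ) (a : A) : Prop :=
  ∀ ξ : Ext (ModuleCat.of A T) (ModuleCat.of A N) j, a • ξ = 0

variable {A}
variable {T N N₁ N₂ N₃ : Type u} [AddCommGroup T] [Module A T] [AddCommGroup N] [Module A N]
  [AddCommGroup N₁] [Module A N₁] [AddCommGroup N₂] [Module A N₂] [AddCommGroup N₃] [Module A N₃]

/-- The short complex attached to an exact pair. -/
def sc (f : N₁ →ₗ[A] N₂) (g : N₂ →ₗ[A] N₃) (hfg : Function.Exact f g) :
    ShortComplex (ModuleCat.{u} A) :=
  ModuleCat.shortComplexOfCompEqZero f g hfg.linearMap_comp_eq_zero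

lemma sc_se (f : N₁ →ₗ[A] N₂) (g : N₂ →ₗ[A] N₃) (hf : Function.Injective f)
    (hg : Function.Surjective g) (hfg : Function.Exact f g) : (sc f g hfg).ShortExact where
  exact := ModuleCat.shortComplex_exact _ hfg
  mono_f := by simpa [sc, ModuleCat.mono_iff_injective] using! hf
  epi_g := by simpa [sc, ModuleCat.epi_iff_surjective] using! hg

lemma KE.mul_left {j : ℕ} {a : A} (h : KE A T N j a) (b : A) : KE A T N j (b * a) := by
  intro ξ; rw [mul_smul, h ξ, smul_zero]

lemma KE.mul_right {j : ℕ} {a : A} (h : KE A T N j a) (b : A) : KE A T N j (a * b) := by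
  rw [mul_comm]; exact h.mul_left b

lemma KE.of_one {j : ℕ} (h : KE A T N j 1) (b : A) : KE A T N j b := by
  simpa using h.mul_left b

lemma KE.add {j : ℕ} {a b : A} (h : KE A T N j a) (h' : KE A T N j b) : KE A T N j (a + b) := by
  intro ξ; rw [add_smul, h ξ, h' ξ, add_zero]

lemma KE.zero {j : ℕ} : KE A T N j 0 := by
  intro ξ; simp

lemma KE.of_smul_eq_zero {j : ℕ} {a : A} (h : ∀ n : N, a • n = 0) : KE A T N j a := by
  intro ξ
  rw [Ext.smul_eq_comp_mk₀]
  have : a • 𝟙 (ModuleCat.of A N) = 0 := by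
    ext n
    exact h n
  rw [this]; simp

lemma KE.of_smul_eq_zero_left {j : ℕ} {a : A} (h : ∀ n : T, a • n = 0) : KE A T N j a := by
  intro ξ
  have : a • 𝟙 (ModuleCat.of A T) = 0 := by
    ext n
    exact h n
  have h2 : a • ξ = (a • Ext.mk₀ (𝟙 (ModuleCat.of A T))).comp ξ (zero_add _) := by
    rw [Ext.smul_comp, Ext.mk₀_id_comp]
  rw [h2, ← Ext.mk₀_smul, this]; simp

/-- Categorical version of `KE`. -/
def KC (X Y : ModuleCat.{u} A) (j : ℕ) (a : A) : Prop := ∀ ξ : Ext X Y j, a • ξ = 0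

lemma KC.mid {X : ModuleCat.{u} A} {S : ShortComplex (ModuleCat.{u} A)} (hS : S.ShortExact)
    {j : ℕ} {a b : A} (h1 : KC X S.X₁ j a) (h3 : KC X S.X₃ j b) : KC X S.X₂ j (a * b) := by
  intro ξ
  obtain ⟨η, hη⟩ := Ext.covariant_sequence_exact₂ X hS
    (b • ξ) (by rw [Ext.smul_comp]; exact h3 _)
  rw [mul_smul, ← hη, ← Ext.smul_comp, h1 η, Ext.zero_comp]

lemma KC.left {X : ModuleCat.{u} A} {S : ShortComplex (ModuleCat.{u} A)} (hS : S.ShortExact)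
    {j : ℕ} {a b : A} (h3 : KC X S.X₃ j a) (h2 : KC X S.X₂ (j+1) b) :
    KC X S.X₁ (j+1) (a * b) := by
  intro ξ
  obtain ⟨η, hη⟩ := Ext.covariant_sequence_exact₁ X hS
    (b • ξ) (by rw [Ext.smul_comp]; exact h2 _) rfl
  rw [mul_smul, ← hη, ← Ext.smul_comp, h3 η, Ext.zero_comp]

lemma KC.right {X : ModuleCat.{u} A} {S : ShortComplex (ModuleCat.{u} A)} (hS : S.ShortExact)
    {j : ℕ} {a b : A} (h2 : KC X S.X₂ j a) (h1 : KC X S.X₁ (j+1) b) :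
    KC X S.X₃ j (a * b) := by
  intro ξ
  obtain ⟨η, hη⟩ := Ext.covariant_sequence_exact₃ X hS
    (b • ξ) rfl (by rw [Ext.smul_comp]; exact h1 _)
  rw [mul_smul, ← hη, ← Ext.smul_comp, h2 η, Ext.zero_comp]

lemma KE.mid (f : N₁ →ₗ[A] N₂) (g : N₂ →ₗ[A] N₃) (hf : Function.Injective f)
    (hg : Function.Surjective g) (hfg : Function.Exact f g) {j : ℕ} {a b : A}
    (h1 : KE A T N₁ j a) (h3 : KE A T N₃ j b) : KE A T N₂ j (a * b) :=
  KC.mid (sc_se f g hf hg hfg) h1 h3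

lemma KE.left0 (f : N₁ →ₗ[A] N₂) (hf : Function.Injective f) {a : A}
    (h2 : KE A T N₂ 0 a) : KE A T N₁ 0 a := by
  intro ξ
  have : Mono (ModuleCat.ofHom f) := by simpa [ModuleCat.mono_iff_injective] using! hf
  apply Ext.postcomp_mk₀_injective_of_mono _ (ModuleCat.ofHom f)
  simp only [map_zero]
  change (a • ξ).comp (Ext.mk₀ (ModuleCat.ofHom f)) (add_zero 0) = 0
  rw [Ext.smul_comp]
  exact h2 _

lemma KE.left (f : N₁ →ₗ[A] N₂) (g : N₂ →ₗ[A] N₃) (hf : Function.Injective f)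
    (hg : Function.Surjective g) (hfg : Function.Exact f g) {j : ℕ} {a b : A}
    (h3 : KE A T N₃ j a) (h2 : KE A T N₂ (j+1) b) : KE A T N₁ (j+1) (a * b) :=
  KC.left (sc_se f g hf hg hfg) h3 h2

lemma KE.right (f : N₁ →ₗ[A] N₂) (g : N₂ →ₗ[A] N₃) (hf : Function.Injective f)
    (hg : Function.Surjective g) (hfg : Function.Exact f g) {j : ℕ} {a b : A}
    (h2 : KE A T N₂ j a) (h1 : KE A T N₁ (j+1) b) : KE A T N₃ j (a * b) :=
  KC.right (sc_se f g hf hg hfg) h2 h1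

/-- Multiplication by `x`, where `x` kills `Ext^{j+1}(T,N)`: there is a surjective connecting
map (composition with a fixed class, for all `T` and `j`). -/
lemma exists_conn (x : A) (g : N →ₗ[A] N₃) (hf : Function.Injective (LinearMap.lsmul A N x))
    (hg : Function.Surjective g) (hfg : Function.Exact (LinearMap.lsmul A N x) g) :
    ∃ δ : Ext (ModuleCat.of A N₃) (ModuleCat.of A N) 1, ∀ (X : ModuleCat.{u} A) (j : ℕ),
      KC X (ModuleCat.of A N) (j+1) x → ∀ ξ : Ext X (ModuleCat.of A N) (j+1),
      ∃ η : Ext X (ModuleCat.of A N₃) j, η.comp δ rfl = ξ := by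
  refine ⟨(sc_se _ g hf hg hfg).extClass, fun X j h2 ξ => ?_⟩
  refine Ext.covariant_sequence_exact₁ X (sc_se _ g hf hg hfg) ξ ?_ rfl
  have := h2 ξ
  rw [Ext.smul_eq_comp_mk₀] at this
  exact this

lemma KE.leftx (x : A) (g : N →ₗ[A] N₃) (hf : Function.Injective (LinearMap.lsmul A N x))
    (hg : Function.Surjective g) (hfg : Function.Exact (LinearMap.lsmul A N x) g) {j : ℕ} {a : A}
    (h2 : KE A T N (j+1) x) (h3 : KE A T N₃ j a) : KE A T N (j+1) a := by
  intro ξ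
  obtain ⟨δ, h⟩ := exists_conn x g hf hg hfg
  obtain ⟨η, hη⟩ := h _ j h2 ξ
  rw [← hη, ← Ext.smul_comp, h3 η, Ext.zero_comp]

lemma KE.zero_iff {a : A} : KE A T N 0 a ↔ ∀ f : T →ₗ[A] N, ∀ t, a • f t = 0 := by
  constructor
  · intro h f t
    have := h (Ext.mk₀ (ModuleCat.ofHom f))
    rw [← Ext.mk₀_smul, Ext.mk₀_eq_zero_iff] at this
    have h2 := congrArg (fun φ => φ.hom t) this
    exact h2
  · intro h ξ
    obtain ⟨f, rfl⟩ := (Ext.mk₀_bijective _ _).2 ξ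
    rw [← Ext.mk₀_smul, Ext.mk₀_eq_zero_iff]
    ext t
    exact h f.hom t

lemma KE.congr (e : N₁ ≃ₗ[A] N₂) {j : ℕ} {a : A} (h : KE A T N₁ j a) : KE A T N₂ j a := by
  intro ξ
  have h1 := h (ξ.comp (Ext.mk₀ (ModuleCat.ofHom e.symm.toLinearMap)) (add_zero _))
  have h2 : ξ = (ξ.comp (Ext.mk₀ (ModuleCat.ofHom e.symm.toLinearMap)) (add_zero _)).comp
      (Ext.mk₀ (ModuleCat.ofHom e.toLinearMap)) (add_zero _) := by
    rw [Ext.comp_assoc_of_third_deg_zero, Ext.mk₀_comp_mk₀, ← ModuleCat.ofHom_comp]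
    simp
  rw [h2, ← Ext.smul_comp, h1]
  simp

lemma KE.lift {j : ℕ} [Subsingleton N] (a : A) : KE A T N j a :=
  KE.of_smul_eq_zero (fun _ => Subsingleton.elim _ _)

end KE

end PF

end Part1

section Part2

set_option linter.unusedSectionVars false
set_option linter.unusedVariables false

namespace PF

section Basics

variable {A : Type u} [CommRing A]
variable {N N₃ : Type u} [AddCommGroup N] [Module A N] [AddCommGroup N₃] [Module A N₃]

lemma ass_iff [IsNoetherianRing A] {P : Ideal A} :
    P ∈ associatedPrimes A N ↔ P.IsPrime ∧ ∃ x : N, ∀ a, a ∈ P ↔ a • x = 0 := by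
  rw [AssociatedPrimes.mem_iff, isAssociatedPrime_iff]
  refine and_congr_right fun _ => exists_congr fun x => ?_
  rw [SetLike.ext_iff]
  refine forall_congr' fun a => ?_
  rw [Submodule.mem_colon_singleton, Submodule.mem_bot]

lemma not_reg_of_ass [IsNoetherianRing A] {P : Ideal A} (hP : P ∈ associatedPrimes A N) {x : A}
    (hx : x ∈ P) : ¬ IsSMulRegular N x := by
  intro h
  obtain ⟨hp, n, hn⟩ := ass_iff.1 hP
  have h0 : n = 0 := h (by simpa using (hn x).1 hx)
  apply hp.ne_top
  rw [Ideal.eq_top_iff_one, hn, h0, smul_zero]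

lemma reg_of_ass [IsNoetherianRing A] {x : A}
    (hx : ∀ P ∈ associatedPrimes A N, x ∉ P) : IsSMulRegular N x := by
  rw [isSMulRegular_iff_right_eq_zero_of_smul]
  intro n hn
  by_contra h0
  obtain ⟨P, hP, hle⟩ := exists_le_isAssociatedPrime_of_isNoetherianRing A n h0
  exact hx P hP (hle (by rw [Submodule.mem_colon_singleton, Submodule.mem_bot]; exact hn))

lemma exists_reg [IsNoetherianRing A] [Module.Finite A N] (I : Ideal A)
    (h : ∀ P ∈ associatedPrimes A N, ¬ I ≤ P) : ∃ x ∈ I, IsSMulRegular N x := by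
  have fin := associatedPrimes.finite A N
  by_contra hcon
  push Not at hcon
  have hsub : (I : Set A) ⊆ ⋃ P ∈ associatedPrimes A N, (id P : Ideal A) := by
    intro x hx
    have := hcon x hx
    by_contra h2
    apply this
    apply reg_of_ass
    intro P hP hxP
    apply h2
    simp only [Set.mem_iUnion]
    exact ⟨P, hP, hxP⟩
  obtain ⟨P, hP, hle⟩ :=
    (I.subset_union_prime_finite fin (f := id) 0 0 fun _ h _ _ ↦ h.isPrime).1 hsub
  exact h P hP hle

/-- The sequence `0 → N → N → N₃ → 0` with maps `x` and `g` is exact. -/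
structure RQ (x : A) (g : N →ₗ[A] N₃) : Prop where
  inj : Function.Injective (LinearMap.lsmul A N x)
  surj : Function.Surjective g
  exact : Function.Exact (LinearMap.lsmul A N x) g

lemma RQ.reg {x : A} {g : N →ₗ[A] N₃} (h : RQ x g) : IsSMulRegular N x := h.inj

open Pointwise in
lemma RQ.of_reg {x : A} (h : IsSMulRegular N x) : RQ x (x • (⊤ : Submodule A N)).mkQ :=
  ⟨h, Submodule.mkQ_surjective _, LinearMap.exact_lsmul_mkQ_smul_top N x⟩

lemma RQ.ideal {I : Ideal A} {x : A} (h : IsSMulRegular (A ⧸ I) x) :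
    RQ x (Submodule.factor (le_sup_left : I ≤ I ⊔ Ideal.span {x})) := by
  refine ⟨h, Submodule.factor_surjective _, ?_⟩
  intro y
  obtain ⟨y, rfl⟩ := Submodule.mkQ_surjective _ y
  constructor
  · intro hy
    have hy' : y ∈ I ⊔ Ideal.span {x} := by
      have : Submodule.factor (le_sup_left : I ≤ I ⊔ Ideal.span {x}) (Submodule.mkQ I y) =
        Submodule.mkQ (I ⊔ Ideal.span {x}) y := rfl
      rw [this] at hy
      exact (Submodule.Quotient.mk_eq_zero _).1 hy
    obtain ⟨i, hi, z, hz, rfl⟩ := Submodule.mem_sup.1 hy'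
    obtain ⟨c, rfl⟩ := Ideal.mem_span_singleton'.1 hz
    refine ⟨Submodule.mkQ I c, ?_⟩
    have h1 : Submodule.mkQ I i = 0 := (Submodule.Quotient.mk_eq_zero _).2 hi
    rw [map_add, h1, zero_add, mul_comm, ← smul_eq_mul, map_smul]
    rfl
  · rintro ⟨z, hz⟩
    obtain ⟨z, rfl⟩ := Submodule.mkQ_surjective _ z
    rw [← hz]
    change Submodule.mkQ (I ⊔ Ideal.span {x}) (x • z) = 0
    simp only [Submodule.mkQ_apply, Submodule.Quotient.mk_eq_zero]
    exact Ideal.mem_sup_right (by rw [smul_eq_mul, mul_comm]; exact Ideal.mem_span_singleton'.2 ⟨z, rfl⟩)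

lemma ass_lift [IsNoetherianRing A] [Module.Finite A N] {P Q : Ideal A}
    (hP : P ∈ associatedPrimes A N) [hQ : Q.IsPrime] {x : A} {g : N →ₗ[A] N₃} (hg : RQ x g)
    (hxQ : x ∈ Q) (hPQ : P ≤ Q) : ∃ P' ∈ associatedPrimes A N₃, P < P' ∧ P' ≤ Q := by
  obtain ⟨hp, n, hn⟩ := ass_iff.1 hP
  let K : Submodule A N := Submodule.torsionBySet A N (P : Set A)
  have hK : ∀ k, k ∈ K ↔ ∀ p ∈ P, p • k = 0 := by
    intro k
    simp [K, Submodule.mem_torsionBySet_iff]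
  have hnK : n ∈ K := (hK n).2 fun p hp => (hn p).1 hp
  have hQs : (⟨Q, hQ⟩ : PrimeSpectrum A) ∈ Module.support A (QuotSMulTop x K) := by
    rw [Module.support_quotSMulTop]
    refine ⟨?_, by simpa using hxQ⟩
    rw [Module.support_eq_zeroLocus, PrimeSpectrum.mem_zeroLocus]
    intro a ha
    apply hPQ
    have := Module.mem_annihilator.1 ha ⟨n, hnK⟩
    rw [hn]
    simpa using congrArg Subtype.val this
  rw [Module.support_eq_zeroLocus, PrimeSpectrum.mem_zeroLocus] at hQs
  obtain ⟨P', hP', hle⟩ := Ideal.exists_minimalPrimes_le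
    (show Module.annihilator A (QuotSMulTop x K) ≤ Q from hQs)
  have hA := Module.associatedPrimes.minimalPrimes_annihilator_subset_associatedPrimes
    (R := A) (M := QuotSMulTop x K) hP'
  have hPle : P ≤ P' := by
    refine le_trans ?_ hP'.1.2
    intro p hp
    rw [Module.mem_annihilator]
    intro k
    obtain ⟨k, rfl⟩ := Submodule.mkQ_surjective _ k
    rw [← map_smul]
    have : p • k = 0 := Subtype.ext ((hK _).1 k.2 p hp)
    rw [this, map_zero]
  have hxP' : x ∈ P' := by
    apply hP'.1.2
    rw [Module.mem_annihilator]
    intro k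
    obtain ⟨k, rfl⟩ := Submodule.mkQ_surjective _ k
    rw [← map_smul]
    simp only [Submodule.mkQ_apply, Submodule.Quotient.mk_eq_zero]
    exact Submodule.smul_mem_pointwise_smul _ _ _ trivial
  have hxP : x ∉ P := fun h => not_reg_of_ass hP h hg.reg
  refine ⟨P', ?_, lt_of_le_of_ne hPle (fun h => hxP (h ▸ hxP')), hle⟩
  let φ : QuotSMulTop x K →ₗ[A] N₃ := Submodule.liftQ _ (g ∘ₗ K.subtype) (by
    intro k hk
    obtain ⟨k', -, rfl⟩ := (Submodule.mem_smul_pointwise_iff_exists _ _ _).1 hk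
    rw [LinearMap.mem_ker]
    exact (hg.exact _).2 ⟨k', rfl⟩)
  refine associatedPrimes.subset_of_injective (f := φ) ?_ hA
  rw [← LinearMap.ker_eq_bot, LinearMap.ker_eq_bot']
  intro k hk
  obtain ⟨k, rfl⟩ := Submodule.mkQ_surjective _ k
  have hk' : g k = 0 := hk
  obtain ⟨z, hz⟩ := (hg.exact _).1 hk'
  have hz' : x • z = k := hz
  have hzK : z ∈ K := by
    rw [hK]
    intro p hp
    apply hg.reg
    change x • p • z = x • 0
    rw [smul_comm, hz', smul_zero]
    exact (hK _).1 k.2 p hp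
  simp only [Submodule.mkQ_apply, Submodule.Quotient.mk_eq_zero]
  rw [show k = x • (⟨z, hzK⟩ : K) from Subtype.ext hz'.symm]
  exact Submodule.smul_mem_pointwise_smul _ _ _ trivial

lemma dim_step {P P' : Ideal A} [hP : P.IsPrime] (h : P < P') :
    ringKrullDim (A ⧸ P') + 1 ≤ ringKrullDim (A ⧸ P) := by
  obtain ⟨x, hx, hxP⟩ := SetLike.exists_of_lt h
  refine ringKrullDim_succ_le_of_surjective (Ideal.Quotient.factor h.le)
    (Ideal.Quotient.factor_surjective _) (r := Ideal.Quotient.mk P x) ?_ ?_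
  · apply mem_nonZeroDivisors_of_ne_zero
    rwa [Ne, Ideal.Quotient.eq_zero_iff_mem]
  · simpa [Ideal.Quotient.eq_zero_iff_mem] using hx

lemma dim_mono {P P' : Ideal A} (h : P ≤ P') :
    ringKrullDim (A ⧸ P') ≤ ringKrullDim (A ⧸ P) :=
  ringKrullDim_le_of_surjective (Ideal.Quotient.factor h) (Ideal.Quotient.factor_surjective _)

lemma exists_dim [IsLocalRing A] [IsNoetherianRing A] {I : Ideal A} (h : I ≠ ⊤) :
    ∃ n : ℕ, ringKrullDim (A ⧸ I) = n := by
  have : Nontrivial (A ⧸ I) := Ideal.Quotient.nontrivial_iff.2 h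
  have : IsLocalRing (A ⧸ I) :=
    IsLocalRing.of_surjective' (Ideal.Quotient.mk I) Ideal.Quotient.mk_surjective
  have h1 : ringKrullDim (A ⧸ I) ≠ ⊤ := ringKrullDim_ne_top
  have h2 : ringKrullDim (A ⧸ I) ≠ ⊥ := ringKrullDim_ne_bot
  obtain ⟨k, hk⟩ := WithBot.ne_bot_iff_exists.1 h2
  rw [← hk] at h1 ⊢
  have h3 : k ≠ ⊤ := fun h => h1 (by rw [h]; rfl)
  obtain ⟨n, hn⟩ := ENat.ne_top_iff_exists.1 h3
  exact ⟨n, by rw [← hn]; rfl⟩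

end Basics

section Z

variable (A : Type u) [CommRing A] [IsLocalRing A]

def Z (N : Type u) [AddCommGroup N] [Module A N] (e : ℕ) : Prop :=
  ∀ j < e, ∀ t : ℕ, KE A (A ⧸ maximalIdeal A ^ t) N j 1

variable {A}
variable {T N N₃ : Type u} [AddCommGroup N] [Module A N] [AddCommGroup N₃] [Module A N₃]
  [AddCommGroup T] [Module A T]

lemma KE.cancel {x : A} {g : N →ₗ[A] N₃} (hg : RQ x g) {j : ℕ} {b : A}
    (h3 : KE A T N₃ j 1) (h : KE A T N (j+1) (x * b)) : KE A T N (j+1) b := by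
  intro ξ
  obtain ⟨η, hη⟩ := CategoryTheory.Abelian.Ext.covariant_sequence_exact₁ (ModuleCat.of A T)
    (sc_se _ g hg.inj hg.surj hg.exact) (b • ξ) (by
      have := h ξ
      rw [mul_smul, CategoryTheory.Abelian.Ext.smul_eq_comp_mk₀ _ x] at this
      exact this) rfl
  have h4 : η = 0 := (one_smul A η).symm.trans (h3 η)
  rw [← hη, h4]
  exact CategoryTheory.Abelian.Ext.zero_comp (C := ModuleCat.{u} A) _ _ (sc_se _ g hg.inj hg.surj hg.exact).extClass _ _

lemma Z.mono {e e' : ℕ} (h : Z A N e) (hle : e' ≤ e) : Z A N e' :=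
  fun j hj t => h j (lt_of_lt_of_le hj hle) t

lemma pow_smul_quot (t : ℕ) {x : A} (hx : x ∈ maximalIdeal A)
    (n : A ⧸ maximalIdeal A ^ t) : x ^ t • n = 0 := by
  obtain ⟨n, rfl⟩ := Ideal.Quotient.mk_surjective n
  rw [← Ideal.Quotient.mk_eq_mk, ← Submodule.Quotient.mk_smul, Submodule.Quotient.mk_eq_zero]
  exact Ideal.mul_mem_right _ _ (Ideal.pow_mem_pow hx t)

lemma Z.of_reg {x : A} (hx : x ∈ maximalIdeal A) {g : N →ₗ[A] N₃} (hg : RQ x g) {e : ℕ}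
    (h : Z A N₃ e) : Z A N (e+1) := by
  intro j hj t
  have hk : KE A (A ⧸ maximalIdeal A ^ t) N j (x ^ t) :=
    KE.of_smul_eq_zero_left (pow_smul_quot t hx)
  cases j with
  | zero =>
    rw [KE.zero_iff] at hk ⊢
    intro f n
    rw [one_smul]
    exact (isSMulRegular_iff_right_eq_zero_of_smul.1 (hg.reg.pow t)) _ (hk f n)
  | succ j =>
    have h3 := h j (by omega) t
    have : ∀ k, KE A (A ⧸ maximalIdeal A ^ t) N (j+1) (x ^ k) →
        KE A (A ⧸ maximalIdeal A ^ t) N (j+1) 1 := by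
      intro k
      induction k with
      | zero => simp
      | succ k ih =>
        intro hh
        rw [pow_succ'] at hh
        exact ih (KE.cancel hg h3 hh)
    exact this t hk

lemma Z.quot {x : A} {g : N →ₗ[A] N₃} (hg : RQ x g) {e : ℕ}
    (h : Z A N (e+1)) : Z A N₃ e := by
  intro j hj t
  simpa using KE.right _ g hg.inj hg.surj hg.exact (h j (by omega) t) (h (j+1) (by omega) t)

open RingTheory.Sequence in
lemma Z.of_seq {N : Type u} [AddCommGroup N] [Module A N] (rs : List A)
    (hm : ∀ r ∈ rs, r ∈ maximalIdeal A) (h : IsWeaklyRegular N rs) : Z A N rs.length := by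
  induction rs generalizing N with
  | nil => intro j hj; simp at hj
  | cons r rs ih =>
    rw [isWeaklyRegular_cons_iff] at h
    have := ih (fun r hr => hm r (List.mem_cons_of_mem _ hr)) h.2
    exact Z.of_reg (hm r List.mem_cons_self) (RQ.of_reg h.1) this

lemma max_not_ass [IsNoetherianRing A] (h : Z A N 1) : maximalIdeal A ∉ associatedPrimes A N := by
  intro hm
  obtain ⟨hp, n, hn⟩ := ass_iff.1 hm
  have := KE.zero_iff.1 (h 0 (by omega) 1)
    (Submodule.liftQ _ (LinearMap.toSpanSingleton A N n) (by
      intro a ha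
      rw [LinearMap.mem_ker, LinearMap.toSpanSingleton_apply]
      exact (hn a).1 (by simpa using ha))) (Submodule.Quotient.mk 1)
  rw [one_smul, Submodule.liftQ_apply, LinearMap.toSpanSingleton_apply, ← hn] at this
  exact hp.ne_top ((Ideal.eq_top_iff_one _).2 this)

lemma exists_reg_max [IsNoetherianRing A] [Module.Finite A N]
    (h : maximalIdeal A ∉ associatedPrimes A N) : ∃ x ∈ maximalIdeal A, IsSMulRegular N x := by
  apply exists_reg
  intro P hP hle
  have : P = maximalIdeal A :=
    le_antisymm (le_maximalIdeal hP.isPrime.ne_top) hle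
  exact h (this ▸ hP)

lemma Z.ass_dim [IsNoetherianRing A] {e : ℕ} {N : Type u} [AddCommGroup N] [Module A N]
    [Module.Finite A N] (h : Z A N e) {P : Ideal A} (hP : P ∈ associatedPrimes A N) :
    (e : WithBot ℕ∞) ≤ ringKrullDim (A ⧸ P) := by
  induction e generalizing N P with
  | zero =>
    obtain ⟨n, hn⟩ := exists_dim hP.isPrime.ne_top
    rw [hn]
    exact_mod_cast Nat.zero_le n
  | succ e ih =>
    obtain ⟨x, hx, hr⟩ := exists_reg_max (max_not_ass (h.mono (by omega : 1 ≤ e + 1)))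
    have hg := RQ.of_reg hr
    obtain ⟨P', hP', hlt, hle⟩ := ass_lift hP hg hx (le_maximalIdeal hP.isPrime.ne_top)
    have h1 := ih (h.quot hg) hP'
    have := hP.isPrime
    refine le_trans ?_ (dim_step hlt)
    push_cast
    gcongr

end Z

end PF

end Part2

section Part3

set_option linter.unusedSectionVars false
set_option linter.unusedVariables false

namespace PF

open CategoryTheory CategoryTheory.Abelian in
lemma KC.chase {A : Type u} [CommRing A] {X K L Rg C : ModuleCat.{u} A} {k : K ⟶ L} {p : L ⟶ Rg}
    {w1 : k ≫ p = 0} (h1 : (ShortComplex.mk k p w1).ShortExact)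
    {i : Rg ⟶ L} {c : L ⟶ C} {w2 : i ≫ c = 0} (h2 : (ShortComplex.mk i c w2).ShortExact)
    {x u v a : A} (hx : p ≫ i = x • 𝟙 L) {j : ℕ} (hu : KC X L j (u * x)) (hv : KC X K j v)
    (ha : ∀ j', j = j' + 1 → KC X C j' a) : KC X L j (v * (a * u)) := by
  intro ξ
  have e1 : ((u • ξ).comp (Ext.mk₀ p) (add_zero j)).comp (Ext.mk₀ i) (add_zero j) = 0 := by
    rw [Ext.comp_assoc_of_third_deg_zero, Ext.mk₀_comp_mk₀, hx, ← Ext.smul_eq_comp_mk₀,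
      ← mul_smul, mul_comm]
    exact hu ξ
  have e2 : ((a * u) • ξ).comp (Ext.mk₀ p) (add_zero j) = 0 := by
    cases j with
    | zero =>
      have := h2.mono_f
      have : (u • ξ).comp (Ext.mk₀ p) (add_zero 0) = 0 := by
        apply Ext.postcomp_mk₀_injective_of_mono _ i
        rw [map_zero]
        exact e1
      rw [mul_smul, Ext.smul_comp, this, smul_zero]
    | succ j =>
      obtain ⟨η, hη⟩ := Ext.covariant_sequence_exact₁ X h2 _ e1 rfl
      rw [mul_smul, Ext.smul_comp, ← hη, ← Ext.smul_comp]
      have := ha j rfl η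
      dsimp only
      rw [this, Ext.zero_comp]
  obtain ⟨η, hη⟩ := Ext.covariant_sequence_exact₂ X h1 _ e2
  rw [mul_smul, ← hη, ← Ext.smul_comp]
  have := hv η
  dsimp only
  rw [this, Ext.zero_comp]

section

variable {A : Type u} [CommRing A]
variable {T K L Rg C : Type u} [AddCommGroup T] [Module A T] [AddCommGroup K] [Module A K]
  [AddCommGroup L] [Module A L] [AddCommGroup C] [Module A C]

lemma KE.chase {x u v a : A} (c : L →ₗ[A] C) (hc : Function.Surjective c)
    (hex : Function.Exact (LinearMap.lsmul A L x) c) {j : ℕ} (hu : KE A T L j (u * x))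
    (hv : ∀ z : L, x • z = 0 → v • z = 0)
    (ha : ∀ j', j = j' + 1 → KE A T C j' a) : KE A T L j (v * (a * u)) := by
  let φ := LinearMap.lsmul A L x
  have ex1 : Function.Exact (LinearMap.ker φ).subtype φ.rangeRestrict := by
    intro z
    simp [Subtype.ext_iff]
  have ex2 : Function.Exact (LinearMap.range φ).subtype c := by
    intro z
    rw [hex z]
    simp [φ]
  exact KC.chase (sc_se _ _ (Submodule.subtype_injective _) (LinearMap.surjective_rangeRestrict φ) ex1)
    (sc_se _ _ (Submodule.subtype_injective _) hc ex2) (by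
      ext z
      rfl) hu (KE.of_smul_eq_zero (N := LinearMap.ker φ) (fun z => Subtype.ext (hv z z.2))) ha

end

section

variable (A : Type u) [CommRing A] [IsLocalRing A]

def G (I : Ideal A) (e : ℕ) : Prop := Z A (A ⧸ I) e ∧ ringKrullDim (A ⧸ I) ≤ e

def Kill (P : Ideal A) (j : ℕ) (N : Type u) [AddCommGroup N] [Module A N] : Prop :=
  ∃ a, a ∉ P ∧ ∀ t : ℕ, KE A (A ⧸ maximalIdeal A ^ t) N j a

inductive CI (I0 : Ideal A) (e0 : ℕ) : Ideal A → ℕ → Prop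
  | base : CI I0 e0 I0 e0
  | step (I : Ideal A) (e : ℕ) (x : A) (h : CI I0 e0 I (e+1)) (hx : x ∈ maximalIdeal A)
      (hr : IsSMulRegular (A ⧸ I) x) : CI I0 e0 (I ⊔ Ideal.span {x}) e

def HH (M : Type u) [AddCommGroup M] [Module A M] (I0 : Ideal A) (e0 : ℕ) (P : Ideal A) : Prop :=
  ∀ (I : Ideal A) (e : ℕ) (x : A), CI A I0 e0 I e → I ≤ P → x ∈ P → IsSMulRegular (A ⧸ I) x →
    ∃ v, v ∉ P ∧ ∀ z : M, x • z ∈ (I • ⊤ : Submodule A M) → v • z ∈ (I • ⊤ : Submodule A M)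

variable {A}

lemma le_of_succ_le {a b : WithBot ℕ∞} (h : a + 1 ≤ b + 1) : a ≤ b := by
  induction a with
  | bot => exact bot_le
  | coe a =>
    induction b with
    | bot =>
      exfalso
      rw [WithBot.bot_add, le_bot_iff] at h
      exact WithBot.coe_ne_bot h
    | coe b =>
      have h' : a + 1 ≤ b + 1 := by exact_mod_cast h
      exact_mod_cast (ENat.add_le_add_iff_right ENat.one_ne_top).1 h'

lemma smulreg_mem_nzd {I : Ideal A} {x : A} (hr : IsSMulRegular (A ⧸ I) x) :
    Ideal.Quotient.mk I x ∈ nonZeroDivisors (A ⧸ I) := by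
  rw [mem_nonZeroDivisors_iff_right]
  intro y hy
  apply isSMulRegular_iff_right_eq_zero_of_smul.1 hr
  rw [Algebra.smul_def, mul_comm]
  exact hy

lemma G.step {I : Ideal A} {e : ℕ} {x : A} (h : G A I (e+1)) 
    (hr : IsSMulRegular (A ⧸ I) x) : G A (I ⊔ Ideal.span {x}) e := by
  refine ⟨h.1.quot (RQ.ideal hr), ?_⟩
  have h1 : ringKrullDim (A ⧸ I ⊔ Ideal.span {x}) + 1 ≤ ringKrullDim (A ⧸ I) := by
    refine ringKrullDim_succ_le_of_surjective (Ideal.Quotient.factor le_sup_left)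
      (Ideal.Quotient.factor_surjective _) (r := Ideal.Quotient.mk I x) (smulreg_mem_nzd hr) ?_
    have : x ∈ I ⊔ Ideal.span {x} := Ideal.mem_sup_right (Ideal.mem_span_singleton_self x)
    simpa only [Ideal.Quotient.factor_mk, Ideal.Quotient.eq_zero_iff_mem] using this
  have h2 := h1.trans h.2
  push_cast at h2
  exact le_of_succ_le h2

lemma CI.G {I0 : Ideal A} {e0 : ℕ} (h0 : G A I0 e0) {I : Ideal A} {e : ℕ} (h : CI A I0 e0 I e) :
    G A I e := by
  induction h with
  | base => exact h0
  | step I e x h hx hr ih => exact ih.step hr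

lemma not_succ_le (n : ℕ) {a b : WithBot ℕ∞} (h1 : a + 1 ≤ b) (h2 : b ≤ n) (h3 : (n : WithBot ℕ∞) ≤ a) :
    False := by
  have h4 : (n : WithBot ℕ∞) + 1 ≤ n := (add_le_add_left h3 1).trans (h1.trans h2)
  have : ((n + 1 : ℕ) : WithBot ℕ∞) ≤ (n : ℕ) := by push_cast; exact h4
  have : n + 1 ≤ n := by exact_mod_cast this
  omega

lemma min_of_dim {I P : Ideal A} [hP : P.IsPrime] (hIP : I ≤ P) {e : ℕ} 
    (h : ringKrullDim (A ⧸ I) ≤ e) (he : (e : WithBot ℕ∞) ≤ ringKrullDim (A ⧸ P)) :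
    P ∈ I.minimalPrimes := by
  refine ⟨⟨hP, hIP⟩, ?_⟩
  rintro q ⟨hq, hIq⟩ hle
  by_contra hcon
  have hlt : q < P := lt_of_le_not_ge hle hcon
  exact not_succ_le e (dim_step hlt) ((dim_mono hIq).trans h) he

variable [IsNoetherianRing A]

lemma le_of_ass_quot {I P : Ideal A} (h : P ∈ associatedPrimes A (A ⧸ I)) : I ≤ P := by
  have := IsAssociatedPrime.annihilator_le h
  rwa [Submodule.annihilator_top, Ideal.annihilator_quotient] at this

lemma G.min {I : Ideal A} {e : ℕ} (h : G A I e) {P : Ideal A}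
    (hP : P ∈ associatedPrimes A (A ⧸ I)) : P ∈ I.minimalPrimes := by
  have := hP.isPrime
  exact min_of_dim (le_of_ass_quot hP) h.2 (h.1.ass_dim hP)

lemma ass_of_min {I : Ideal A} {P : Ideal A}
    (hP : P ∈ I.minimalPrimes) : P ∈ associatedPrimes A (A ⧸ I) := by
  apply Module.associatedPrimes.minimalPrimes_annihilator_subset_associatedPrimes
  rwa [Ideal.annihilator_quotient]

lemma base_kill {I P : Ideal A} (hP : P ∈ I.minimalPrimes) {e : ℕ} (hZ : Z A (A ⧸ I) e) (j : ℕ)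
    (hj : j < e) (N : Type u) [AddCommGroup N] [Module A N] [hN : Module.Finite A N]
    (hI : ∀ i ∈ I, ∀ n : N, i • n = 0) : Kill A P j N := by
  have hprime : P.IsPrime := hP.1.1
  induction j generalizing N with
  | zero =>
    revert hI
    refine IsNoetherianRing.induction_on_isQuotientEquivQuotientPrime A (M := N) hN 
      (motive := fun N _ _ _ => (∀ i ∈ I, ∀ n : N, i • n = 0) → Kill A P 0 N) ?_ ?_ ?_
    · intro N _ _ _ _ _
      exact ⟨1, fun h => hprime.ne_top ((Ideal.eq_top_iff_one _).2 h), fun t => KE.lift _⟩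
    · intro N _ _ _ q e hI
      by_cases hq : q.1 ≤ P
      · have hIq : I ≤ q.1 := by
          intro i hi
          have h1 := hI i hi (e.symm (Ideal.Quotient.mk _ 1))
          rw [← map_smul, LinearEquiv.map_eq_zero_iff] at h1
          rw [← Ideal.Quotient.eq_zero_iff_mem, ← h1, Algebra.smul_def, map_one, mul_one]
          rfl
        have : q.1 = P := le_antisymm hq (hP.2 ⟨q.2, hIq⟩ hq)
        have hinj := ((isAssociatedPrime_iff_exists_injective_linearMap _ _).1 (ass_of_min hP)).2
        obtain ⟨f, hf⟩ := hinj
        rw [this] at e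
        exact ⟨1, fun h => hprime.ne_top ((Ideal.eq_top_iff_one _).2 h), fun t =>
          KE.left0 (f ∘ₗ e.toLinearMap) (hf.comp e.injective) (hZ 0 hj t)⟩
      · obtain ⟨a, ha, haP⟩ := SetLike.not_le_iff_exists.1 hq
        refine ⟨a, haP, fun t => KE.of_smul_eq_zero fun n => ?_⟩
        apply e.injective
        rw [map_smul, map_zero]
        obtain ⟨b, hb⟩ := Ideal.Quotient.mk_surjective (e n)
        rw [← hb, Algebra.smul_def]
        change Ideal.Quotient.mk _ _ * _ = 0
        rw [← map_mul, Ideal.Quotient.eq_zero_iff_mem]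
        exact Ideal.mul_mem_right _ _ ha
    · intro N₁ _ _ _ N₂ _ _ _ N₃ _ _ _ f g hf hg hfg h1 h3 hI
      obtain ⟨a, ha, ha'⟩ := h1 fun i hi n => hf (by rw [map_smul, hI i hi, map_zero])
      obtain ⟨b, hb, hb'⟩ := h3 fun i hi n => by
        obtain ⟨n, rfl⟩ := hg n
        rw [← map_smul, hI i hi, map_zero]
      exact ⟨a * b, fun h => (hprime.mem_or_mem h).elim ha hb,
        fun t => KE.mid f g hf hg hfg (ha' t) (hb' t)⟩
  | succ j ih =>
    revert hI
    refine IsNoetherianRing.induction_on_isQuotientEquivQuotientPrime A (M := N) hN 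
      (motive := fun N _ _ _ => (∀ i ∈ I, ∀ n : N, i • n = 0) → Kill A P (j+1) N) ?_ ?_ ?_
    · intro N _ _ _ _ _
      exact ⟨1, fun h => hprime.ne_top ((Ideal.eq_top_iff_one _).2 h), fun t => KE.lift _⟩
    · intro N _ _ _ q e hI
      by_cases hq : q.1 ≤ P
      · have hIq : I ≤ q.1 := by
          intro i hi
          have h1 := hI i hi (e.symm (Ideal.Quotient.mk _ 1))
          rw [← map_smul, LinearEquiv.map_eq_zero_iff] at h1
          rw [← Ideal.Quotient.eq_zero_iff_mem, ← h1, Algebra.smul_def, map_one, mul_one]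
          rfl
        have : q.1 = P := le_antisymm hq (hP.2 ⟨q.2, hIq⟩ hq)
        have hinj := ((isAssociatedPrime_iff_exists_injective_linearMap _ _).1 (ass_of_min hP)).2
        obtain ⟨f, hf⟩ := hinj
        rw [this] at e
        let F := f ∘ₗ e.toLinearMap
        have hF : Function.Injective F := hf.comp e.injective
        obtain ⟨a, ha, ha'⟩ := ih (by omega) ((A ⧸ I) ⧸ LinearMap.range F) (by
          intro i hi n
          obtain ⟨n, rfl⟩ := Submodule.mkQ_surjective _ n
          obtain ⟨n, rfl⟩ := Ideal.Quotient.mk_surjective n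
          rw [← map_smul, Algebra.smul_def]
          change Submodule.mkQ _ (Ideal.Quotient.mk _ _ * _) = 0
          rw [Ideal.Quotient.eq_zero_iff_mem.2 hi, zero_mul, map_zero])
        refine ⟨a, ha, fun t => ?_⟩
        have := KE.left F (LinearMap.range F).mkQ hF (Submodule.mkQ_surjective _)
          (LinearMap.exact_map_mkQ_range F) (ha' t) (hZ (j+1) hj t)
        rwa [mul_one] at this
      · obtain ⟨a, ha, haP⟩ := SetLike.not_le_iff_exists.1 hq
        refine ⟨a, haP, fun t => KE.of_smul_eq_zero fun n => ?_⟩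
        apply e.injective
        rw [map_smul, map_zero]
        obtain ⟨b, hb⟩ := Ideal.Quotient.mk_surjective (e n)
        rw [← hb, Algebra.smul_def]
        change Ideal.Quotient.mk _ _ * _ = 0
        rw [← map_mul, Ideal.Quotient.eq_zero_iff_mem]
        exact Ideal.mul_mem_right _ _ ha
    · intro N₁ _ _ _ N₂ _ _ _ N₃ _ _ _ f g hf hg hfg h1 h3 hI
      obtain ⟨a, ha, ha'⟩ := h1 fun i hi n => hf (by rw [map_smul, hI i hi, map_zero])
      obtain ⟨b, hb, hb'⟩ := h3 fun i hi n => by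
        obtain ⟨n, rfl⟩ := hg n
        rw [← map_smul, hI i hi, map_zero]
      exact ⟨a * b, fun h => (hprime.mem_or_mem h).elim ha hb,
        fun t => KE.mid f g hf hg hfg (ha' t) (hb' t)⟩

/-- The ideal killing all `Ext^j(A/m^t, N)`. -/
def killIdeal (N : Type u) [AddCommGroup N] [Module A N] (j : ℕ) : Ideal A where
  carrier := {a | ∀ t : ℕ, KE A (A ⧸ maximalIdeal A ^ t) N j a}
  add_mem' ha hb t := (ha t).add (hb t)
  zero_mem' t := KE.zero
  smul_mem' c a ha t := (ha t).mul_left c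

lemma HH.mono {M : Type u} [AddCommGroup M] [Module A M] {I0 : Ideal A} {e0 : ℕ} {P Q : Ideal A}
    (h : HH A M I0 e0 P) (hle : Q ≤ P) : HH A M I0 e0 Q := by
  intro I e x hC hI hx hr
  obtain ⟨v, hv, h⟩ := h I e x hC (hI.trans hle) (hle hx) hr
  exact ⟨v, fun h => hv (hle h), h⟩

lemma factor_exact (M : Type u) [AddCommGroup M] [Module A M] (I : Ideal A) (x : A) :
    Function.Exact (LinearMap.lsmul A (M ⧸ (I • ⊤ : Submodule A M)) x)
      (Submodule.factor (Submodule.smul_mono_left (le_sup_left : I ≤ I ⊔ Ideal.span {x}) :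
        (I • ⊤ : Submodule A M) ≤ (I ⊔ Ideal.span {x}) • ⊤)) := by
  intro z
  obtain ⟨z, rfl⟩ := Submodule.mkQ_surjective _ z
  change Submodule.mkQ ((I ⊔ Ideal.span {x}) • ⊤ : Submodule A M) z = 0 ↔ _
  rw [Submodule.mkQ_apply, Submodule.Quotient.mk_eq_zero, Submodule.sup_smul, Submodule.mem_sup]
  constructor
  · rintro ⟨y, hy, w, hw, rfl⟩
    rw [Submodule.ideal_span_singleton_smul] at hw
    obtain ⟨w, -, rfl⟩ := (Submodule.mem_smul_pointwise_iff_exists _ _ _).1 hw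
    refine ⟨Submodule.mkQ _ w, ?_⟩
    rw [map_add, (by simpa using hy : Submodule.mkQ (I • ⊤ : Submodule A M) y = 0), zero_add,
      map_smul]
    rfl
  · rintro ⟨w, hw⟩
    obtain ⟨w, rfl⟩ := Submodule.mkQ_surjective _ w
    have h1 : Submodule.mkQ (I • ⊤ : Submodule A M) (x • w) = Submodule.mkQ _ z := hw
    have h2 : z - x • w ∈ (I • ⊤ : Submodule A M) := by
      rw [← Submodule.Quotient.mk_eq_zero, ← Submodule.mkQ_apply, map_sub, h1, sub_self]
    refine ⟨_, h2, x • w, ?_, by abel⟩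
    rw [Submodule.ideal_span_singleton_smul]
    exact Submodule.smul_mem_pointwise_smul _ _ _ trivial

theorem main_kill (M : Type u) [AddCommGroup M] [Module A M] [Module.Finite A M] {I0 : Ideal A}
    {e0 : ℕ} (h0 : G A I0 e0) (r : ℕ) : ∀ (P : Ideal A) [P.IsPrime] (I : Ideal A) (e : ℕ),
    CI A I0 e0 I e → I ≤ P → HH A M I0 e0 P → (e : WithBot ℕ∞) ≤ ringKrullDim (A ⧸ P) + r →
    ∀ j < e, Kill A P j (M ⧸ (I • ⊤ : Submodule A M)) := by
  induction r with
  | zero =>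
    intro P hP I e hC hIP hH he j hj
    have hG := hC.G h0
    have hmin : P ∈ I.minimalPrimes := min_of_dim hIP hG.2 (by simpa using he)
    refine base_kill hmin hG.1 j hj _ ?_
    intro i hi n
    obtain ⟨n, rfl⟩ := Submodule.mkQ_surjective _ n
    rw [← map_smul, Submodule.mkQ_apply, Submodule.Quotient.mk_eq_zero]
    exact Submodule.smul_mem_smul hi trivial
  | succ r IH =>
    intro P hP I e hC hIP hH he j hj
    have hG := hC.G h0
    have hIkill : ∀ i ∈ I, ∀ n : M ⧸ (I • ⊤ : Submodule A M), i • n = 0 := by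
      intro i hi n
      obtain ⟨n, rfl⟩ := Submodule.mkQ_surjective _ n
      rw [← map_smul, Submodule.mkQ_apply, Submodule.Quotient.mk_eq_zero]
      exact Submodule.smul_mem_smul hi trivial
    by_cases hmin : P ∈ I.minimalPrimes
    · exact base_kill hmin hG.1 j hj _ hIkill
    set b := killIdeal (A := A) (M ⧸ (I • ⊤ : Submodule A M)) j with hb
    by_cases hbP : b ≤ P
    swap
    · obtain ⟨a, ha, haP⟩ := SetLike.not_le_iff_exists.1 hbP
      exact ⟨a, haP, ha⟩
    have hIb : I ≤ b := fun i hi t => KE.of_smul_eq_zero (hIkill i hi)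
    have hbmin : P ∈ b.minimalPrimes := by
      refine ⟨⟨hP, hbP⟩, ?_⟩
      rintro q ⟨hq, hbq⟩ hle
      by_contra hcon
      have hlt : q < P := lt_of_le_not_ge hle hcon
      obtain ⟨a, ha, ha'⟩ := IH q I e hC (hIb.trans hbq) (hH.mono hle) (by
        refine he.trans ?_
        push_cast
        rw [add_comm (r : WithBot ℕ∞), ← add_assoc]
        gcongr
        exact dim_step hlt) j hj
      exact ha (hbq ha')
    obtain ⟨x, hxP, hxr⟩ := exists_reg (N := A ⧸ I) P (by
      intro Q hQ hle
      have h1 := hG.min hQ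
      have : P = Q := le_antisymm hle (h1.2 ⟨hP, hIP⟩ hle)
      exact hmin (this ▸ h1))
    obtain ⟨u, n, huP, hu⟩ : ∃ u n, u ∉ P ∧ u * x ^ (n+1) ∈ b := by
      by_contra hcon
      push Not at hcon
      obtain ⟨q, hq, hbq, hdis⟩ := Ideal.exists_le_prime_disjoint b
        (P.primeCompl ⊔ Submonoid.powers x) (by
          rw [Set.disjoint_left]
          intro y hyb hy
          obtain ⟨u, hu, z, hz, rfl⟩ := Submonoid.mem_sup.1 hy
          obtain ⟨n, rfl⟩ := hz
          apply hcon u n hu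
          rw [pow_succ, ← mul_assoc]
          exact Ideal.mul_mem_right _ _ hyb)
      have hqP : q ≤ P := by
        intro y hy
        by_contra hyP
        exact Set.disjoint_left.1 hdis hy (Submonoid.mem_sup_left (show y ∈ P.primeCompl from hyP))
      have := hbmin.2 ⟨hq, hbq⟩ hqP hxP
      exact Set.disjoint_left.1 hdis this (Submonoid.mem_sup_right (Submonoid.mem_powers x))
    obtain ⟨e, rfl⟩ : ∃ e', e = e' + 1 := ⟨e - 1, by omega⟩
    have hxm : x ^ (n+1) ∈ maximalIdeal A :=
      le_maximalIdeal hP.ne_top (Ideal.pow_mem_of_mem _ hxP _ (by omega))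
    have hC' := CI.step I e (x ^ (n+1)) hC hxm (hxr.pow _)
    have hJP : I ⊔ Ideal.span {x ^ (n+1)} ≤ P := by
      refine sup_le hIP ?_
      rw [Ideal.span_singleton_le_iff_mem]
      exact Ideal.pow_mem_of_mem _ hxP _ (by omega)
    obtain ⟨a, ha, ha'⟩ : ∃ a, a ∉ P ∧ ∀ t j', j = j' + 1 →
        KE A (A ⧸ maximalIdeal A ^ t)
          (M ⧸ ((I ⊔ Ideal.span {x ^ (n+1)}) • ⊤ : Submodule A M)) j' a := by
      cases j with
      | zero => exact ⟨1, fun h => hP.ne_top ((Ideal.eq_top_iff_one _).2 h), by omega⟩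
      | succ j =>
        obtain ⟨a, ha, ha'⟩ := IH P _ e hC' hJP hH (by
          have : (e : WithBot ℕ∞) + 1 ≤ ringKrullDim (A ⧸ P) + r + 1 := by
            push_cast at he
            rwa [add_assoc]
          exact le_of_succ_le this) j (by omega)
        refine ⟨a, ha, fun t j' hj' => ?_⟩
        obtain rfl : j = j' := by omega
        exact ha' t
    obtain ⟨v, hv, hv'⟩ := hH I _ (x ^ (n+1)) hC hIP (Ideal.pow_mem_of_mem _ hxP _ (by omega)) (hxr.pow _)
    refine ⟨v * (a * u), fun h => (hP.mem_or_mem h).elim hv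
      fun h => (hP.mem_or_mem h).elim ha huP, fun t => ?_⟩
    refine KE.chase _ (Submodule.factor_surjective _) (factor_exact M I (x ^ (n+1))) (hu t) ?_ (ha' t)
    intro z hz
    obtain ⟨z, rfl⟩ := Submodule.mkQ_surjective _ z
    rw [← map_smul, Submodule.mkQ_apply, Submodule.Quotient.mk_eq_zero] at hz ⊢
    exact hv' z hz

end

end PF

end Part3

section Part4

set_option linter.unusedSectionVars false
set_option linter.unusedVariables false

namespace PF

section

variable {A : Type u} [CommRing A] [IsLocalRing A]

lemma CI.inv {I0 : Ideal A} {e0 : ℕ} {I : Ideal A} {e : ℕ} (h : CI A I0 e0 I e) :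
    e ≤ e0 ∧ (e = e0 → I = I0) ∧ (e + 1 = e0 → ∃ y ∈ maximalIdeal A, IsSMulRegular (A ⧸ I0) y ∧
      I = I0 ⊔ Ideal.span {y}) := by
  induction h with
  | base => exact ⟨le_rfl, fun _ => rfl, by omega⟩
  | step I e x h hx hr ih =>
    refine ⟨by omega, by omega, fun he => ⟨x, hx, ?_, ?_⟩⟩
    · rw [← ih.2.1 he]; exact hr
    · rw [← ih.2.1 he]

variable [IsNoetherianRing A]

lemma zero_le_dim {P : Ideal A} (hP : P ≠ ⊤) : 0 ≤ ringKrullDim (A ⧸ P) := by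
  obtain ⟨n, hn⟩ := exists_dim hP
  rw [hn]
  exact_mod_cast Nat.zero_le n

lemma one_le_dim {P : Ideal A} [hP : P.IsPrime] (h : P ≠ maximalIdeal A) :
    1 ≤ ringKrullDim (A ⧸ P) := by
  have hlt : P < maximalIdeal A := lt_of_le_of_ne (le_maximalIdeal hP.ne_top) h
  refine le_trans ?_ (dim_step hlt)
  have := zero_le_dim (A := A) (P := maximalIdeal A) (Ideal.IsPrime.ne_top inferInstance)
  simpa using add_le_add_left this 1

variable {M : Type u} [AddCommGroup M] [Module A M] [Module.Finite A M]

lemma app1 {d : ℕ} (hA : G A ⊥ d) (hD : ringKrullDim (A ⧸ Module.annihilator A M) = 3) :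
    ∃ I0 ≤ Module.annihilator A M, G A I0 3 := by
  classical
  have hex : ∃ e, ∃ I ≤ Module.annihilator A M, G A I e := ⟨d, ⊥, bot_le, hA⟩
  obtain ⟨I, hI, hG⟩ := Nat.find_spec hex
  have hmin := fun m (hm : m < Nat.find hex) => Nat.find_min hex hm
  generalize Nat.find hex = e at hG hmin
  have h3 : (3 : ℕ) ≤ e := by
    have := (dim_mono hI).trans hG.2
    rw [hD] at this
    exact_mod_cast this
  by_cases he : e = 3
  · exact ⟨I, hI, he ▸ hG⟩
  exfalso
  obtain ⟨e, rfl⟩ : ∃ k, e = k + 1 := ⟨e - 1, by omega⟩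
  obtain ⟨x, hx, hr⟩ := exists_reg (N := A ⧸ I) (Module.annihilator A M) (by
    intro P hP hle
    have h1 := hG.1.ass_dim hP
    have h2 := h1.trans (dim_mono hle)
    rw [hD] at h2
    have : e + 1 ≤ 3 := by exact_mod_cast h2
    omega)
  exact hmin e (by omega) ⟨_, sup_le hI (by rwa [Ideal.span_singleton_le_iff_mem]), hG.step hr⟩

lemma app2 {I0 : Ideal A} (hI : I0 ≤ Module.annihilator A M) (hG : G A I0 3)
    (hU : ∀ q ∈ associatedPrimes A M, ringKrullDim (A ⧸ q) = 3) {q : Ideal A}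
    (hq : q ∈ associatedPrimes A M) : q ∈ associatedPrimes A (A ⧸ I0) := by
  apply ass_of_min
  have := hq.isPrime
  have hle : Module.annihilator A M ≤ q := by
    have := IsAssociatedPrime.annihilator_le hq
    rwa [Submodule.annihilator_top] at this
  exact min_of_dim (hI.trans hle) hG.2 (by rw [hU q hq]; exact le_rfl)

lemma app2' {I0 : Ideal A} (hI : I0 ≤ Module.annihilator A M) (hG : G A I0 3)
    (hU : ∀ q ∈ associatedPrimes A M, ringKrullDim (A ⧸ q) = 3) {x : A}
    (hx : IsSMulRegular (A ⧸ I0) x) : IsSMulRegular M x :=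
  reg_of_ass fun _ hq hxq => not_reg_of_ass (app2 hI hG hU hq) hxq hx

lemma app3 {I0 : Ideal A} (hI : I0 ≤ Module.annihilator A M) (hG : G A I0 3)
    (hU : ∀ q ∈ associatedPrimes A M, ringKrullDim (A ⧸ q) = 3)
    (hS : ∀ Q q0 q1 : Ideal A, Q.IsPrime → q0.IsPrime → q1.IsPrime → q0 < q1 → q1 < Q →
      Module.annihilator A M ≤ q0 → ∀ y ∈ Q, IsSMulRegular M y →
      Q ∉ associatedPrimes A (QuotSMulTop y M)) {y x : A}
    (hy : IsSMulRegular (A ⧸ I0) y) (hx : IsSMulRegular (A ⧸ I0 ⊔ Ideal.span {y}) x) :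
    IsSMulRegular (QuotSMulTop y M) x := by
  apply reg_of_ass
  intro Q hQ hxQ
  have hQp := hQ.isPrime
  have hAnn : Module.annihilator A (QuotSMulTop y M) ≤ Q := by
    have := IsAssociatedPrime.annihilator_le hQ
    rwa [Submodule.annihilator_top] at this
  have hyQ : y ∈ Q := by
    apply hAnn
    rw [Module.mem_annihilator]
    intro k
    obtain ⟨k, rfl⟩ := Submodule.mkQ_surjective _ k
    rw [← map_smul]
    simp only [Submodule.mkQ_apply, Submodule.Quotient.mk_eq_zero]
    exact Submodule.smul_mem_pointwise_smul _ _ _ trivial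
  have hAM : Module.annihilator A M ≤ Q :=
    le_trans (LinearMap.annihilator_le_of_surjective (Submodule.mkQ _)
      (Submodule.mkQ_surjective _)) hAnn
  obtain ⟨q0, hq0, hq0Q⟩ := Ideal.exists_minimalPrimes_le hAM
  have hq0A := Module.associatedPrimes.minimalPrimes_annihilator_subset_associatedPrimes (R := A) (M := M) hq0
  obtain ⟨P', hP', hlt, hle⟩ := ass_lift (app2 hI hG hU hq0A) (RQ.ideal hy) hyQ hq0Q
  have hxP' : x ∉ P' := fun h => not_reg_of_ass hP' h hx
  have hlt' : P' < Q := lt_of_le_of_ne hle (fun h => hxP' (h ▸ hxQ))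
  exact hS Q q0 P' hQp hq0A.isPrime hP'.isPrime hlt hlt' hq0.1.2 y hyQ (app2' hI hG hU hy) hQ

lemma sup_smul_eq {I0 : Ideal A} (hI : I0 ≤ Module.annihilator A M) (y : A) :
    ((I0 ⊔ Ideal.span {y}) • ⊤ : Submodule A M) = Ideal.span {y} • ⊤ := by
  have : (I0 • ⊤ : Submodule A M) = ⊥ := by
    rw [eq_bot_iff, Submodule.smul_le]
    intro r hr n _
    rw [Submodule.mem_bot]
    exact Module.mem_annihilator.1 (hI hr) n
  rw [Submodule.sup_smul, this, bot_sup_eq]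

lemma app4 {I0 : Ideal A} (hI : I0 ≤ Module.annihilator A M) (hG : G A I0 3)
    (hU : ∀ q ∈ associatedPrimes A M, ringKrullDim (A ⧸ q) = 3)
    (hS : ∀ Q q0 q1 : Ideal A, Q.IsPrime → q0.IsPrime → q1.IsPrime → q0 < q1 → q1 < Q →
      Module.annihilator A M ≤ q0 → ∀ y ∈ Q, IsSMulRegular M y →
      Q ∉ associatedPrimes A (QuotSMulTop y M)) {P : Ideal A} [hP : P.IsPrime]
    (hPm : P ≠ maximalIdeal A) : HH A M I0 3 P := by
  intro I e x hC hIP hxP hr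
  obtain ⟨h1, h2, h3⟩ := hC.inv
  have hone : (1 : A) ∉ P := fun h => hP.ne_top ((Ideal.eq_top_iff_one _).2 h)
  have hGI := hC.G hG
  have hd := one_le_dim hPm
  have hI0 : (I0 • ⊤ : Submodule A M) = ⊥ := by
    rw [eq_bot_iff, Submodule.smul_le]
    intro r hr n _
    rw [Submodule.mem_bot]
    exact Module.mem_annihilator.1 (hI hr) n
  match e, h1 with
  | 0, _ =>
    exfalso
    have := hd.trans ((dim_mono hIP).trans hGI.2)
    exact absurd (by exact_mod_cast this : (1:ℕ) ≤ 0) (by omega)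
  | 1, _ =>
    exfalso
    have := hd.trans ((dim_mono (sup_le hIP (by rwa [Ideal.span_singleton_le_iff_mem]))).trans
      (hGI.step hr).2)
    exact absurd (by exact_mod_cast this : (1:ℕ) ≤ 0) (by omega)
  | 2, _ =>
    obtain ⟨y, hy, hyr, rfl⟩ := h3 rfl
    refine ⟨1, hone, fun z hz => ?_⟩
    rw [one_smul]
    rw [sup_smul_eq hI, Submodule.ideal_span_singleton_smul] at hz ⊢
    rw [← Submodule.Quotient.mk_eq_zero] at hz ⊢
    rw [Submodule.Quotient.mk_smul] at hz
    exact isSMulRegular_iff_right_eq_zero_of_smul.1 (app3 hI hG hU hS hyr hr) _ hz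
  | 3, _ =>
    obtain rfl := h2 rfl
    refine ⟨1, hone, fun z hz => ?_⟩
    rw [one_smul]
    rw [hI0, Submodule.mem_bot] at hz ⊢
    exact isSMulRegular_iff_right_eq_zero_of_smul.1 (app2' hI hG hU hr) _ hz

theorem kill2 {d : ℕ} (hA : G A ⊥ d) (hD : ringKrullDim (A ⧸ Module.annihilator A M) = 3)
    (hU : ∀ q ∈ associatedPrimes A M, ringKrullDim (A ⧸ q) = 3)
    (hS : ∀ Q q0 q1 : Ideal A, Q.IsPrime → q0.IsPrime → q1.IsPrime → q0 < q1 → q1 < Q →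
      Module.annihilator A M ≤ q0 → ∀ y ∈ Q, IsSMulRegular M y →
      Q ∉ associatedPrimes A (QuotSMulTop y M)) :
    ∃ n : ℕ, maximalIdeal A ^ n ≤ killIdeal M 2 := by
  obtain ⟨I0, hI, hG⟩ := app1 hA hD
  have key : ∀ P : Ideal A, P.IsPrime → killIdeal (A := A) M 2 ≤ P → P = maximalIdeal A := by
    intro P hP hle
    by_contra hPm
    have hI0 : (I0 • ⊤ : Submodule A M) = ⊥ := by
      rw [eq_bot_iff, Submodule.smul_le]
      intro r hr n _
      rw [Submodule.mem_bot]
      exact Module.mem_annihilator.1 (hI hr) n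
    by_cases hIP : I0 ≤ P
    · obtain ⟨a, ha, hk⟩ := main_kill M hG 3 P I0 3 CI.base hIP (app4 hI hG hU hS hPm)
        (by simpa using add_le_add_left (zero_le_dim hP.ne_top) 3) 2 (by omega)
      refine ha (hle fun t => ?_)
      exact KE.congr (Submodule.quotEquivOfEqBot _ hI0) (hk t)
    · obtain ⟨a, ha, haP⟩ := SetLike.not_le_iff_exists.1 hIP
      exact haP (hle fun t => KE.of_smul_eq_zero fun n => Module.mem_annihilator.1 (hI ha) n)
  have hrad : maximalIdeal A ≤ (killIdeal (A := A) M 2).radical := by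
    rw [Ideal.radical_eq_sInf]
    refine le_sInf ?_
    rintro P ⟨h1, h2⟩
    rw [key P h2 h1]
  exact Ideal.exists_pow_le_of_le_radical_of_fg hrad (IsNoetherian.noetherian _)

end

end PF

end Part4

section Part5
open scoped Pointwise

set_option linter.unusedSectionVars false
set_option linter.unusedVariables false
set_option linter.style.haveILetI false
set_option linter.deprecated false

namespace PF

section

lemma depth_Z {A : Type u} [CommRing A] [IsLocalRing A] {N : Type u} [AddCommGroup N] [Module A N]
    {n : ℕ} (h : (n : WithTop ℕ) < depth A N) : Z A N (n+1) := by
  obtain ⟨a, ⟨rs, rfl, hm, hr⟩, hlt⟩ := lt_sSup_iff.1 h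
  exact (Z.of_seq rs hm hr.1).mono (by exact_mod_cast hlt)

lemma two_le_dim {A : Type u} [CommRing A] [IsLocalRing A] [IsNoetherianRing A] {I p0 p1 p2 : Ideal A}
    [h0 : p0.IsPrime] [h1 : p1.IsPrime] [h2 : p2.IsPrime] (h : I ≤ p0) (h01 : p0 < p1) (h12 : p1 < p2) :
    2 ≤ ringKrullDim (A ⧸ I) := by
  have a := zero_le_dim (A := A) h2.ne_top
  have b := dim_step h12
  have c := dim_step h01
  have d := dim_mono h
  calc (2 : WithBot ℕ∞) = 0 + 1 + 1 := by norm_num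
    _ ≤ ringKrullDim (A ⧸ p2) + 1 + 1 := by gcongr
    _ ≤ ringKrullDim (A ⧸ p1) + 1 := by gcongr
    _ ≤ ringKrullDim (A ⧸ p0) := c
    _ ≤ _ := d

lemma one_le_dim' {A : Type u} [CommRing A] [IsLocalRing A] [IsNoetherianRing A] {I p1 p2 : Ideal A}
    [h1 : p1.IsPrime] [h2 : p2.IsPrime] (h : I ≤ p1) (h12 : p1 < p2) :
    1 ≤ ringKrullDim (A ⧸ I) := by
  have a := zero_le_dim (A := A) h2.ne_top
  have b := dim_step h12
  have d := dim_mono h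
  calc (1 : WithBot ℕ∞) = 0 + 1 := by norm_num
    _ ≤ ringKrullDim (A ⧸ p2) + 1 := by gcongr
    _ ≤ ringKrullDim (A ⧸ p1) := b
    _ ≤ _ := d

variable {R : Type u} [CommRing R] [IsNoetherianRing R] {S : Type u} [AddCommGroup S] [Module R S]
  [Module.Finite R S]

lemma ann_loc {Q : Ideal R} [Q.IsPrime] {q : Ideal R} [hq : q.IsPrime] (hqQ : q ≤ Q)
    (h : Module.annihilator R S ≤ q) :
    Module.annihilator (Localization.AtPrime Q) (LocalizedModule Q.primeCompl S) ≤
      q.map (algebraMap R (Localization.AtPrime Q)) := by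
  classical
  intro a ha
  obtain ⟨⟨r, s⟩, hrs⟩ := IsLocalization.surj Q.primeCompl a
  have hr : algebraMap R (Localization.AtPrime Q) r ∈
      Module.annihilator (Localization.AtPrime Q) (LocalizedModule Q.primeCompl S) := by
    rw [← hrs]; exact Ideal.mul_mem_right _ _ ha
  have key : ∀ x : S, ∃ t : Q.primeCompl, t • r • x = 0 := by
    intro x
    rw [← IsLocalizedModule.eq_zero_iff Q.primeCompl (LocalizedModule.mkLinearMap Q.primeCompl S)]
    rw [map_smul, ← algebraMap_smul (Localization.AtPrime Q) r]
    exact Module.mem_annihilator.1 hr _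
  obtain ⟨T, hT⟩ := (‹Module.Finite R S›).fg_top
  choose t ht using key
  have : r ∈ q := by
    have hmem : ((∏ x ∈ T, t x : Q.primeCompl) : R) * r ∈ Module.annihilator R S := by
      rw [Module.mem_annihilator]
      intro m
      have hm : m ∈ Submodule.span R (T : Set S) := hT ▸ Submodule.mem_top
      induction hm using Submodule.span_induction with
      | mem x hx =>
        rw [← Finset.prod_erase_mul _ _ (Finset.mem_coe.1 hx), Submonoid.coe_mul, mul_assoc, mul_smul,
          mul_smul]
        have := ht x
        rw [Submonoid.smul_def] at this
        rw [this, smul_zero]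
      | zero => simp
      | add x y _ _ hx hy => rw [smul_add, hx, hy, add_zero]
      | smul a x _ hx => rw [smul_comm, hx, smul_zero]
    exact (hq.mem_or_mem (h hmem)).resolve_left
      (fun hh => (∏ x ∈ T, t x : Q.primeCompl).2 (hqQ hh))
  have h2 : a * algebraMap R (Localization.AtPrime Q) s ∈ q.map (algebraMap R _) := by
    rw [hrs]; exact Ideal.mem_map_of_mem _ this
  exact (Ideal.mul_unit_mem_iff_mem _ (IsLocalization.map_units _ s)).1 h2

lemma map_prime {Q q : Ideal R} [Q.IsPrime] [hq : q.IsPrime] (h : q ≤ Q) :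
    (q.map (algebraMap R (Localization.AtPrime Q))).IsPrime :=
  IsLocalization.isPrime_of_isPrime_disjoint Q.primeCompl _ q hq
    (Set.disjoint_left.2 fun x hx hx' => hx (h hx'))

lemma comap_map {Q q : Ideal R} [Q.IsPrime] [hq : q.IsPrime] (h : q ≤ Q) :
    (q.map (algebraMap R (Localization.AtPrime Q))).comap (algebraMap R _) = q :=
  IsLocalization.comap_map_of_isPrime_disjoint Q.primeCompl _ hq
    (Set.disjoint_left.2 fun x hx hx' => hx (h hx'))

lemma map_lt {Q q q' : Ideal R} [Q.IsPrime] [hq : q.IsPrime] [hq' : q'.IsPrime] (h : q' ≤ Q) (h' : q < q') :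
    q.map (algebraMap R (Localization.AtPrime Q)) < q'.map (algebraMap R (Localization.AtPrime Q)) := by
  refine lt_of_le_of_ne (Ideal.map_mono h'.le) fun e => h'.ne ?_
  rw [← comap_map (h'.le.trans h), e, comap_map h]

lemma s2_two (h : IsS2 R S) {Q q0 q1 : Ideal R} [Q.IsPrime] [q0.IsPrime] [q1.IsPrime]
    (h01 : q0 < q1) (h1Q : q1 < Q) (hA : Module.annihilator R S ≤ q0) :
    Z (Localization.AtPrime Q) (LocalizedModule Q.primeCompl S) 2 := by
  have hsupp : (⟨Q, inferInstance⟩ : PrimeSpectrum R) ∈ Module.support R S := by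
    rw [Module.support_eq_zeroLocus]; exact hA.trans (h01.le.trans h1Q.le)
  have hh := h _ hsupp
  haveI := map_prime (h1Q.le)
  haveI := map_prime (h01.le.trans h1Q.le)
  haveI := map_prime (le_refl Q)
  have hd : 2 ≤ mdim (Localization.AtPrime Q) (LocalizedModule Q.primeCompl S) :=
    two_le_dim (ann_loc (h01.le.trans h1Q.le) hA) (map_lt h1Q.le h01) (map_lt le_rfl h1Q)
  have this := (le_min le_rfl hd).trans hh
  refine depth_Z (n := 1) (lt_of_lt_of_le ?_ (WithBot.coe_le_coe.1 this : (2 : WithTop ℕ) ≤ _))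
  exact_mod_cast Nat.one_lt_two

lemma s2_one (h : IsS2 R S) {Q q0 : Ideal R} [Q.IsPrime] [q0.IsPrime]
    (h0Q : q0 < Q) (hA : Module.annihilator R S ≤ q0) :
    Z (Localization.AtPrime Q) (LocalizedModule Q.primeCompl S) 1 := by
  have hsupp : (⟨Q, inferInstance⟩ : PrimeSpectrum R) ∈ Module.support R S := by
    rw [Module.support_eq_zeroLocus]; exact hA.trans h0Q.le
  have hh := h _ hsupp
  haveI := map_prime (h0Q.le)
  haveI := map_prime (le_refl Q)
  have hd : 1 ≤ mdim (Localization.AtPrime Q) (LocalizedModule Q.primeCompl S) :=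
    one_le_dim' (ann_loc (h0Q.le) hA) (map_lt le_rfl h0Q)
  have this' := (le_min one_le_two hd).trans hh
  refine depth_Z (n := 0) (lt_of_lt_of_le ?_ (WithBot.coe_le_coe.1 this' : (1 : WithTop ℕ) ≤ _))
  exact_mod_cast Nat.zero_lt_one

lemma s2_ass (h : IsS2 R S) {Q q0 : Ideal R} [Q.IsPrime] [q0.IsPrime]
    (h0Q : q0 < Q) (hA : Module.annihilator R S ≤ q0) : Q ∉ associatedPrimes R S := fun hQ =>
  max_not_ass (s2_one h h0Q hA)
    (Module.associatedPrimes.mem_associatedPrimes_atPrime_of_mem_associatedPrimes hQ)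

lemma s2_quot (h : IsS2 R S) {Q q0 q1 : Ideal R} [Q.IsPrime] [q0.IsPrime] [q1.IsPrime]
    (h01 : q0 < q1) (h1Q : q1 < Q) (hA : Module.annihilator R S ≤ q0) {y : R}
    (hy : IsSMulRegular S y) : Q ∉ associatedPrimes R (QuotSMulTop y S) := fun hQ => by
  have hZ := s2_two h h01 h1Q hA
  have hr := RQ.of_reg hy
  have hRQ : RQ (algebraMap R (Localization.AtPrime Q) y)
      (LocalizedModule.map Q.primeCompl (y • (⊤ : Submodule R S)).mkQ) := by
    have e : ⇑(LinearMap.lsmul (Localization.AtPrime Q) (LocalizedModule Q.primeCompl S)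
        (algebraMap R (Localization.AtPrime Q) y)) =
        ⇑(LocalizedModule.map Q.primeCompl (LinearMap.lsmul R S y)) := by
      ext z
      induction z using LocalizedModule.induction_on with
      | h m s =>
        simp [LocalizedModule.map_mk, LocalizedModule.smul'_mk]
    refine ⟨?_, LocalizedModule.map_surjective _ _ hr.surj, ?_⟩
    · rw [e]; exact LocalizedModule.map_injective _ _ hr.inj
    · rw [e]; exact LocalizedModule.map_exact _ _ _ hr.exact
  exact max_not_ass (Z.quot hRQ hZ)
    (Module.associatedPrimes.mem_associatedPrimes_atPrime_of_mem_associatedPrimes hQ)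

end

end PF

end Part5

section Part6
open scoped Pointwise

set_option linter.unusedSectionVars false
set_option linter.unusedVariables false
set_option linter.style.haveILetI false

namespace PF

section

lemma ass_quot_iff {A : Type u} [CommRing A] [IsNoetherianRing A] {N : Type u} [AddCommGroup N] [Module A N]
    {Q : Ideal A} {y : A} : Q ∈ associatedPrimes A (QuotSMulTop y N) ↔
      Q.IsPrime ∧ ∃ z : N, ∀ a, a ∈ Q ↔ ∃ w : N, y • w = a • z := by
  rw [ass_iff]
  refine and_congr_right fun _ => ?_
  have key : ∀ (z : N) (a : A), a • (Submodule.Quotient.mk z : QuotSMulTop y N) = 0 ↔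
      ∃ w : N, y • w = a • z := by
    intro z a
    rw [← Submodule.Quotient.mk_smul, Submodule.Quotient.mk_eq_zero,
      Submodule.mem_smul_pointwise_iff_exists]
    simp
  constructor
  · rintro ⟨x, hx⟩
    obtain ⟨z, rfl⟩ := Submodule.Quotient.mk_surjective _ x
    exact ⟨z, fun a => (hx a).trans (key z a)⟩
  · rintro ⟨z, hz⟩
    exact ⟨Submodule.Quotient.mk z, fun a => (hz a).trans (key z a).symm⟩

lemma cm_G {A : Type u} [CommRing A] [IsLocalRing A] (h : IsCMLocalRing A) : ∃ d, G A ⊥ d := by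
  obtain ⟨hN, hC⟩ := h
  obtain ⟨d, hd⟩ := exists_dim (A := A) (I := ⊥) bot_ne_top
  have e : mdim A A = d := by
    have : Module.annihilator A A = ⊥ := (Module.annihilator_eq_bot (R := A) (M := A)).2 inferInstance
    exact (congrArg (fun I : Ideal A => ringKrullDim (A ⧸ I)) this).trans hd
  unfold IsCM at hC
  rw [e] at hC
  have hC' : depth A A = (d : WithTop ℕ) := WithBot.coe_injective hC
  refine ⟨d, ?_, hd.le⟩
  have : Z A A d := by
    cases d with
    | zero => intro j hj; omega
    | succ n => exact depth_Z (by rw [hC']; exact_mod_cast Nat.lt_succ_self n)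
  intro j hj t
  exact KE.congr (Submodule.quotEquivOfEqBot (⊥ : Submodule A A) rfl).symm (this j hj t)

variable {A R : Type u} [CommRing A] [IsLocalRing A] [IsNoetherianRing A]
  [CommRing R] [IsLocalRing R] [IsNoetherianRing R] [Algebra A R]
  {M : Type u} [AddCommGroup M] [Module R M] [Module A M] [IsScalarTower A R M]
  [Module.Finite R M]

lemma dim_comap (hf : Function.Surjective (algebraMap A R)) (q : Ideal R) :
    ringKrullDim (A ⧸ q.comap (algebraMap A R)) = ringKrullDim (R ⧸ q) :=
  ringKrullDim_eq_of_ringEquiv (RingEquiv.ofBijective (Ideal.quotientMap q (algebraMap A R) le_rfl)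
    ⟨Ideal.quotientMap_injective, Ideal.quotientMap_surjective hf⟩)

lemma ann_comap : Module.annihilator A M = (Module.annihilator R M).comap (algebraMap A R) := by
  ext a
  simp [Module.mem_annihilator]

lemma ass_comap (hf : Function.Surjective (algebraMap A R)) {q : Ideal A}
    (hq : q ∈ associatedPrimes A M) :
    ∃ q' ∈ associatedPrimes R M, q = q'.comap (algebraMap A R) := by
  obtain ⟨hp, x, hx⟩ := ass_iff.1 hq
  have e : q = Ideal.comap (algebraMap A R) (LinearMap.ker (LinearMap.toSpanSingleton R M x)) := by
    ext a
    rw [hx]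
    simp
  refine ⟨(LinearMap.ker (LinearMap.toSpanSingleton R M x) : Ideal R), ?_, e⟩
  refine ass_iff.2 ⟨?_, x, fun a => by simp⟩
  rw [e] at hp
  rw [← Ideal.map_comap_of_surjective (algebraMap A R) hf (LinearMap.ker (LinearMap.toSpanSingleton R M x))]
  exact Ideal.map_isPrime_of_surjective hf (Ideal.comap_mono bot_le)

theorem kill2_A (hf : Function.Surjective (algebraMap A R)) (hA : IsCMLocalRing A)
    (hD : mdim R M = 3) (hU : IsUnmixed R M)
    (hS : ∀ Q q0 q1 : Ideal R, Q.IsPrime → q0.IsPrime → q1.IsPrime → q0 < q1 → q1 < Q →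
      Module.annihilator R M ≤ q0 → ∀ y ∈ Q, IsSMulRegular M y →
        Q ∉ associatedPrimes R (QuotSMulTop y M)) :
    ∃ n, maximalIdeal A ^ n ≤ killIdeal M 2 := by
  obtain ⟨d, hd⟩ := cm_G hA
  haveI : Module.Finite A R := Module.Finite.of_surjective (Algebra.linearMap A R) hf
  haveI : Module.Finite A M := Module.Finite.trans R M
  have hker : ∀ q : Ideal A, Module.annihilator A M ≤ q → RingHom.ker (algebraMap A R) ≤ q := by
    intro q hq a ha
    apply hq
    rw [Module.mem_annihilator]
    intro m
    rw [← algebraMap_smul R a m, (RingHom.mem_ker).1 ha, zero_smul]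
  have hmap : ∀ q : Ideal A, Module.annihilator A M ≤ q →
      (q.map (algebraMap A R)).comap (algebraMap A R) = q := by
    intro q hq
    rw [Ideal.comap_map_of_surjective' _ hf, sup_eq_left]
    exact hker q hq
  refine kill2 hd ?_ ?_ ?_
  · rw [ann_comap (A := A) (R := R), dim_comap hf]; exact hD
  · intro q hq
    obtain ⟨q', hq', rfl⟩ := ass_comap hf hq
    rw [dim_comap hf]
    exact (hU q' hq').trans hD
  · intro Q q0 q1 hQ h0 h1 h01 h1Q hann y hy hreg hass
    have a1 := hann.trans h01.le
    have aQ := a1.trans h1Q.le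
    have lt : ∀ p q : Ideal A, Module.annihilator A M ≤ p → Module.annihilator A M ≤ q → p < q →
        p.map (algebraMap A R) < q.map (algebraMap A R) := by
      intro p q hp hq hpq
      refine lt_of_le_of_ne (Ideal.map_mono hpq.le) fun e => hpq.ne ?_
      rw [← hmap p hp, e, hmap q hq]
    have pQ := Ideal.map_isPrime_of_surjective hf (hker _ aQ)
    refine hS (Q.map (algebraMap A R)) (q0.map (algebraMap A R)) (q1.map (algebraMap A R))
      pQ
      (Ideal.map_isPrime_of_surjective hf (hker _ hann))
      (Ideal.map_isPrime_of_surjective hf (hker _ a1)) (lt _ _ hann a1 h01) (lt _ _ a1 aQ h1Q) ?_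
      (algebraMap A R y) (Ideal.mem_map_of_mem _ hy) ?_ ?_
    · intro r hr
      obtain ⟨a, rfl⟩ := hf r
      refine Ideal.mem_map_of_mem _ (hann ?_)
      rw [ann_comap (A := A) (R := R)]; exact hr
    · intro m m' h
      apply hreg
      simpa using h
    · obtain ⟨_, z, hz⟩ := ass_quot_iff.1 hass
      refine ass_quot_iff.2 ⟨pQ, z, fun r => ?_⟩
      obtain ⟨a, rfl⟩ := hf r
      have : algebraMap A R a ∈ Q.map (algebraMap A R) ↔ a ∈ Q := by
        rw [← Ideal.mem_comap, hmap Q aQ]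
      rw [this, hz]
      simp

lemma RQ.restrict {N N₃ : Type u} [AddCommGroup N] [Module R N] [Module A N] [IsScalarTower A R N]
    [AddCommGroup N₃] [Module R N₃] [Module A N₃] [IsScalarTower A R N₃] {x : A} {g : N →ₗ[R] N₃}
    (h : RQ (algebraMap A R x) g) : RQ x (g.restrictScalars A) := by
  have e : ⇑(LinearMap.lsmul A N x) = ⇑(LinearMap.lsmul R N (algebraMap A R x)) := by
    ext z; simp
  refine ⟨?_, h.surj, ?_⟩
  · rw [e]; exact h.inj
  · rw [e]; exact h.exact

lemma Z.restrict0 (hf : Function.Surjective (algebraMap A R)) {N : Type u} [AddCommGroup N] [Module R N]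
    [Module A N] [IsScalarTower A R N] {a : A} {t : ℕ}
    (h : KE A (A ⧸ maximalIdeal A ^ t) N 0 a) :
    KE R (R ⧸ maximalIdeal R ^ t) N 0 (algebraMap A R a) := by
  rw [KE.zero_iff] at h ⊢
  intro φ s
  have hk : (maximalIdeal A ^ t : Submodule A A) ≤ LinearMap.ker (LinearMap.toSpanSingleton A N (φ s)) := by
    intro c hc
    have hc' : algebraMap A R c ∈ maximalIdeal R ^ t := by
      rw [← map_maximalIdeal_of_surjective (algebraMap A R) hf, ← Ideal.map_pow]
      exact Ideal.mem_map_of_mem _ hc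
    have hz : algebraMap A R c • s = 0 := by
      obtain ⟨s, rfl⟩ := Ideal.Quotient.mk_surjective s
      rw [← Ideal.Quotient.mk_eq_mk, ← Submodule.Quotient.mk_smul, Submodule.Quotient.mk_eq_zero]
      exact Ideal.mul_mem_right _ _ hc'
    rw [LinearMap.mem_ker, LinearMap.toSpanSingleton_apply, ← algebraMap_smul R c, ← map_smul, hz,
      map_zero]
  have := h (Submodule.liftQ (maximalIdeal A ^ t : Submodule A A)
    (LinearMap.toSpanSingleton A N (φ s)) hk) (Submodule.Quotient.mk 1)
  rw [Submodule.liftQ_apply, LinearMap.toSpanSingleton_apply, one_smul] at this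
  rw [algebraMap_smul]
  exact this

lemma kill2_mid (hf : Function.Surjective (algebraMap A R))
    {N₁ : Type u} [AddCommGroup N₁] [Module R N₁] [Module A N₁] [IsScalarTower A R N₁]
    {N₂ : Type u} [AddCommGroup N₂] [Module R N₂] [Module A N₂] [IsScalarTower A R N₂]
    {y x : R} (hy : y ∈ maximalIdeal R) (hx : x ∈ maximalIdeal R)
    {g₁ : M →ₗ[R] N₁} {g₂ : N₁ →ₗ[R] N₂} (h₁ : RQ y g₁) (h₂ : RQ x g₂) {a : A} {t : ℕ}
    (ha : KE A (A ⧸ maximalIdeal A ^ t) M 2 a) : KE A (A ⧸ maximalIdeal A ^ t) N₂ 0 a := by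
  obtain ⟨y, rfl⟩ := hf y
  obtain ⟨x, rfl⟩ := hf x
  haveI := IsLocalHom.of_surjective (algebraMap A R) hf
  have hy' : y ∈ maximalIdeal A := by
    rw [← maximalIdeal_comap (algebraMap A R)]; exact hy
  have hx' : x ∈ maximalIdeal A := by
    rw [← maximalIdeal_comap (algebraMap A R)]; exact hx
  have r1 := h₁.restrict
  have r2 := h₂.restrict
  have z1 : Z A N₁ 1 := Z.of_reg hx' r2 (e := 0) (fun j hj => by omega)
  have z2 : Z A M 2 := Z.of_reg hy' r1 z1
  have k1 := KE.right _ _ r1.inj r1.surj r1.exact (z2 1 (by omega) t) ha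
  have k2 := KE.right _ _ r2.inj r2.surj r2.exact (z1 0 (by omega) t) k1
  simpa using k2

theorem kill2_R (hf : Function.Surjective (algebraMap A R)) (hZ : Z R M 2)
    (h : ∃ n, maximalIdeal A ^ n ≤ killIdeal M 2) :
    ∃ n, maximalIdeal R ^ n ≤ killIdeal M 2 := by
  obtain ⟨n, hn⟩ := h
  refine ⟨n, ?_⟩
  intro r hr
  rw [← map_maximalIdeal_of_surjective (algebraMap A R) hf, ← Ideal.map_pow,
    Ideal.mem_map_iff_of_surjective _ hf] at hr
  obtain ⟨a, ha, rfl⟩ := hr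
  have hka : ∀ t, KE A (A ⧸ maximalIdeal A ^ t) M 2 a := hn ha
  intro t
  obtain ⟨y, hy, hyr⟩ := exists_reg_max (max_not_ass (hZ.mono one_le_two))
  have r1 := RQ.of_reg (hyr.pow (t+1))
  obtain ⟨x, hx, hxr⟩ := exists_reg_max (max_not_ass (Z.quot r1 hZ))
  have r2 := RQ.of_reg (hxr.pow (t+1))
  refine KE.leftx _ _ r1.inj r1.surj r1.exact (KE.of_smul_eq_zero_left fun z => by
    rw [pow_succ', mul_smul, pow_smul_quot t hy, smul_zero]) ?_
  refine KE.leftx _ _ r2.inj r2.surj r2.exact (KE.of_smul_eq_zero_left fun z => by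
    rw [pow_succ', mul_smul, pow_smul_quot t hx, smul_zero]) ?_
  apply Z.restrict0 hf
  exact kill2_mid hf (Ideal.pow_mem_of_mem _ hy _ (by omega)) (Ideal.pow_mem_of_mem _ hx _ (by omega))
    r1 r2 (hka t)

end

theorem kill2_final {R : Type u} [CommRing R] [IsLocalRing R] [IsNoetherianRing R]
    (hCM : IsQuotientOfCMLocalRing R)
    {M : Type u} [AddCommGroup M] [Module R M] [Module.Finite R M]
    (hD : mdim R M = 3) (hU : IsUnmixed R M) (hZ : Z R M 2)
    (hS : ∀ Q q0 q1 : Ideal R, Q.IsPrime → q0.IsPrime → q1.IsPrime → q0 < q1 → q1 < Q →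
      Module.annihilator R M ≤ q0 → ∀ y ∈ Q, IsSMulRegular M y →
        Q ∉ associatedPrimes R (QuotSMulTop y M)) :
    ∃ n, maximalIdeal R ^ n ≤ killIdeal M 2 := by
  obtain ⟨A, iA, iL, hA, f, hf⟩ := hCM
  haveI := hA.1
  letI := f.toAlgebra
  letI := Module.compHom M f
  haveI : IsScalarTower A R M := IsScalarTower.of_algebraMap_smul fun r x => rfl
  exact kill2_R (A := A) hf hZ (kill2_A hf hA hD hU hS)

end PF

end Part6

section Part7
open CategoryTheory Opposite

set_option linter.unusedSectionVars false
set_option linter.unusedVariables false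
set_option linter.style.haveILetI false

namespace PF

section

variable {R : Type u} [CommRing R] {X X' : ModuleCat.{u} R}

/-- Cocycles. -/
def cocyc (P : ProjectiveResolution X) (Y : ModuleCat.{u} R) (n : ℕ) :
    Submodule R (P.complex.X n ⟶ Y) where
  carrier := {f | P.complex.d (n+1) n ≫ f = 0}
  add_mem' := fun {a b} ha hb => by
    simp only [Set.mem_ofPred_eq] at *
    rw [Preadditive.comp_add, ha, hb, add_zero]
  zero_mem' := by simp
  smul_mem' := fun c x hx => by
    simp only [Set.mem_ofPred_eq] at *
    rw [Linear.comp_smul, hx, smul_zero]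

/-- The functor. -/
noncomputable abbrev FY (Y : ModuleCat.{u} R) : ModuleCat.{u} R ⥤ (ModuleCat.{u} R)ᵒᵖ :=
  ((linearYoneda R (ModuleCat.{u} R)).obj Y).rightOp

/-- The complex. -/
noncomputable abbrev KK (P : ProjectiveResolution X) (Y : ModuleCat.{u} R) :=
  ((FY Y).mapHomologicalComplex (ComplexShape.down ℕ)).obj P.complex

/-- inclusion of cocycles. -/
noncomputable def inc (P : ProjectiveResolution X) (Y : ModuleCat.{u} R) (n : ℕ) :
    (KK P Y).X n ⟶ op (ModuleCat.of R (cocyc P Y n)) :=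
  Quiver.Hom.op (ModuleCat.ofHom (cocyc P Y n).subtype : ModuleCat.of R (cocyc P Y n) ⟶
    ModuleCat.of R (P.complex.X n ⟶ Y))

lemma d_inc (P : ProjectiveResolution X) (Y : ModuleCat.{u} R) (n : ℕ) :
    (KK P Y).d (n+1) n ≫ inc P Y n = 0 := by
  apply Quiver.Hom.unop_inj
  ext f
  exact f.2

/-- class in opcycles -/
noncomputable def cl0 (P : ProjectiveResolution X) (Y : ModuleCat.{u} R) (n : ℕ) :
    (KK P Y).opcycles n ⟶ op (ModuleCat.of R (cocyc P Y n)) :=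
  (KK P Y).descOpcycles (inc P Y n) (n+1) (by simp) (d_inc P Y n)

/-- class of a cocycle in homology -/
noncomputable def cl1 (P : ProjectiveResolution X) (Y : ModuleCat.{u} R) (n : ℕ) :
    (KK P Y).homology n ⟶ op (ModuleCat.of R (cocyc P Y n)) :=
  (KK P Y).homologyι n ≫ cl0 P Y n

lemma cl0_surj (P : ProjectiveResolution X) (Y : ModuleCat.{u} R) (n : ℕ) :
    Function.Surjective (cl0 P Y n).unop := by
  intro z
  have hmono : Mono ((KK P Y).pOpcycles n).unop := inferInstance
  rw [ModuleCat.mono_iff_injective] at hmono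
  let f : P.complex.X n ⟶ Y := ((KK P Y).pOpcycles n).unop z
  have hf : f ∈ cocyc P Y n := by
    have h : ((KK P Y).d (n+1) n ≫ (KK P Y).pOpcycles n).unop z = 0 := by
      rw [HomologicalComplex.d_pOpcycles]; rfl
    exact h
  refine ⟨(⟨f, hf⟩ : cocyc P Y n), hmono ?_⟩
  have h : ((KK P Y).pOpcycles n ≫ cl0 P Y n).unop (⟨f, hf⟩ : cocyc P Y n) =
    (inc P Y n).unop (⟨f, hf⟩ : cocyc P Y n) := by
      rw [cl0, HomologicalComplex.p_descOpcycles]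
  exact h

lemma cl1_surj (P : ProjectiveResolution X) (Y : ModuleCat.{u} R) (n : ℕ) :
    Function.Surjective (cl1 P Y n).unop := by
  have h1 : Epi ((KK P Y).homologyι n).unop := inferInstance
  rw [ModuleCat.epi_iff_surjective] at h1
  exact h1.comp (cl0_surj P Y n)

lemma cl1_bd (P : ProjectiveResolution X) (Y : ModuleCat.{u} R) (p : ℕ)
    (f : cocyc P Y (p+1)) (g : P.complex.X p ⟶ Y) (h : P.complex.d (p+1) p ≫ g = f.1) :
    (cl1 P Y (p+1)).unop f = 0 := by
  have hi : Function.Injective ((KK P Y).pOpcycles (p+1)).unop := by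
    rw [← ModuleCat.mono_iff_injective]; infer_instance
  have e : (cl0 P Y (p+1)).unop f = ((KK P Y).fromOpcycles (p+1) p).unop g := by
    apply hi
    have h1 : ((KK P Y).pOpcycles (p+1) ≫ cl0 P Y (p+1)).unop f =
      (inc P Y (p+1)).unop f := by
        rw [cl0, HomologicalComplex.p_descOpcycles]
    have h2 : ((KK P Y).pOpcycles (p+1) ≫ (KK P Y).fromOpcycles (p+1) p).unop g =
       ((KK P Y).d (p+1) p).unop g := by
         rw [HomologicalComplex.p_fromOpcycles]
    exact h1.trans (h.symm.trans h2.symm)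
  have h3 : ((KK P Y).homologyι (p+1) ≫ (KK P Y).fromOpcycles (p+1) p).unop g = 0 := by
    rw [HomologicalComplex.homologyι_comp_fromOpcycles]; rfl
  change ((KK P Y).homologyι (p+1)).unop ((cl0 P Y (p+1)).unop f) = 0
  rw [e]
  exact h3

/-- precomposition on cocycles -/
def pre {P' : ProjectiveResolution X'} {P : ProjectiveResolution X} (Y : ModuleCat.{u} R)
    (φ : P'.complex ⟶ P.complex) (n : ℕ) : cocyc P Y n →ₗ[R] cocyc P' Y n where
  toFun f := ⟨φ.f n ≫ f.1, by
    change _ ≫ _ = 0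
    rw [← φ.comm_assoc, show P.complex.d (n+1) n ≫ f.1 = 0 from f.2, Limits.comp_zero]⟩
  map_add' f g := by ext1; simp
  map_smul' a f := by ext1; simp

lemma cl1_nat {P' : ProjectiveResolution X'} {P : ProjectiveResolution X} (Y : ModuleCat.{u} R)
    (φ : P'.complex ⟶ P.complex) (n : ℕ) :
    HomologicalComplex.homologyMap (((FY Y).mapHomologicalComplex (ComplexShape.down ℕ)).map φ) n ≫
      cl1 P Y n = cl1 P' Y n ≫ Quiver.Hom.op (ModuleCat.ofHom (pre Y φ n)) := by
  rw [cl1, HomologicalComplex.homologyι_naturality_assoc, cl0,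
    HomologicalComplex.opcyclesMap_comp_descOpcycles, cl1, Category.assoc]
  congr 1
  rw [← cancel_epi ((KK P' Y).pOpcycles n), HomologicalComplex.p_descOpcycles, cl0,
    HomologicalComplex.p_descOpcycles_assoc]
  rfl

lemma paste {C : Type*} [Category C] {A B D E F H : C} {a : A ⟶ B} {b : B ⟶ D} {c : A ⟶ E}
    {d : E ⟶ D} {e : D ⟶ F} {f : E ⟶ H} {g : H ⟶ F} (h : a ≫ b = c ≫ d) (h2 : d ≫ e = f ≫ g) :
    a ≫ (b ≫ e) = (c ≫ f) ≫ g := by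
  rw [Category.assoc, ← h2, reassoc_of% h]

/-- class of a cocycle in old Ext -/
noncomputable def cl (P : ProjectiveResolution X) (Y : ModuleCat.{u} R) (n : ℕ) :
    ModuleCat.of R (cocyc P Y n) ⟶
      ((_root_.Ext R (ModuleCat.{u} R) n).obj (op X)).obj Y :=
  ((P.isoLeftDerivedObj (FY Y) n).hom ≫ cl1 P Y n).unop

lemma cl_surj (P : ProjectiveResolution X) (Y : ModuleCat.{u} R) (n : ℕ) :
    Function.Surjective (cl P Y n) := by
  have h1 : Epi (P.isoLeftDerivedObj (FY Y) n).hom.unop := inferInstance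
  rw [ModuleCat.epi_iff_surjective] at h1
  exact h1.comp (cl1_surj P Y n)

lemma cl_bd (P : ProjectiveResolution X) (Y : ModuleCat.{u} R) (p : ℕ)
    (f : cocyc P Y (p+1)) (g : P.complex.X p ⟶ Y) (h : P.complex.d (p+1) p ≫ g = f.1) :
    cl P Y (p+1) f = 0 := by
  change (P.isoLeftDerivedObj (FY Y) (p+1)).hom.unop ((cl1 P Y (p+1)).unop f) = 0
  rw [cl1_bd P Y p f g h]
  exact map_zero _

lemma cl_nat {P' : ProjectiveResolution X'} {P : ProjectiveResolution X} (Y : ModuleCat.{u} R)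
    (s : X' ⟶ X) (φ : P'.complex ⟶ P.complex) (hφ : φ.f 0 ≫ P.π.f 0 = P'.π.f 0 ≫ s) (n : ℕ) :
    cl P Y n ≫ ((_root_.Ext R (ModuleCat.{u} R) n).map s.op).app Y =
      ModuleCat.ofHom (pre Y φ n) ≫ cl P' Y n := by
  apply Quiver.Hom.op_inj
  have h := ProjectiveResolution.isoLeftDerivedObj_hom_naturality s P' P φ hφ (FY Y) n
  have h2 := cl1_nat Y φ n
  change ((FY Y).leftDerived n).map s ≫ ((P.isoLeftDerivedObj (FY Y) n).hom ≫ cl1 P Y n) =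
    ((P'.isoLeftDerivedObj (FY Y) n).hom ≫ cl1 P' Y n) ≫ (ModuleCat.ofHom (pre Y φ n)).op
  exact paste h h2

end

end PF

end Part7

section Part8
open CategoryTheory Opposite

set_option linter.unusedSectionVars false
set_option linter.unusedVariables false
set_option linter.style.haveILetI false

namespace PF

section

variable {R : Type u} [CommRing R]

/-- The object `R/J^t`. -/
abbrev XJ (J : Ideal R) (t : ℕ) : ModuleCat.{u} R := ModuleCat.of R (R ⧸ J ^ t)

/-- Projection `R/J^t → R/J^s`. -/
def prj (J : Ideal R) {s t : ℕ} (h : s ≤ t) : XJ J t ⟶ XJ J s :=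
  ModuleCat.ofHom (Submodule.mapQ _ _ LinearMap.id (Ideal.pow_le_pow_right h : J ^ t ≤ J ^ s))

theorem loc_theta (J : Ideal R) (i : ℕ) (Y : ModuleCat.{u} R)
    (P : ∀ t, ProjectiveResolution (XJ J t)) :
    ∃ θ : ∀ t, cocyc (P t) Y i →ₗ[R] ((localCohomology J i).obj Y),
      (∀ h, ∃ t f, θ t f = h) ∧
      (∀ t p (hp : p + 1 = i) (f : cocyc (P t) Y i) (g : (P t).complex.X p ⟶ Y),
        (P t).complex.d i p ≫ g = f.1 → θ t f = 0) ∧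
      (∀ s t (h : s ≤ t) (φ : (P t).complex ⟶ (P s).complex),
        φ.f 0 ≫ (P s).π.f 0 = (P t).π.f 0 ≫ prj J h → ∀ f, θ t (pre Y φ i f) = θ s f) := by
  let D := localCohomology.diagram (localCohomology.idealPowersDiagram J) i
  haveI : Limits.HasColimit D := localCohomology.hasColimitDiagram _ _
  let η : ∀ t : ℕ, ((_root_.Ext R (ModuleCat.{u} R) i).obj (op (XJ J t))).obj Y ⟶
      (localCohomology J i).obj Y := fun t => (Limits.colimit.ι D (op (op t))).app Y
  refine ⟨fun t => (cl (P t) Y i ≫ η t).hom, ?_, ?_, ?_⟩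
  · intro h
    have hc := Limits.isColimitOfPreserves ((evaluation _ _).obj Y) (Limits.colimit.isColimit D)
    haveI : Limits.PreservesFilteredColimitsOfSize.{0, 0} (forget (ModuleCat.{u} R)) :=
      Limits.preservesSmallestFilteredColimits_of_preservesFilteredColimits.{u, u} _
    haveI : Limits.PreservesColimitsOfShape (ℕᵒᵖ)ᵒᵖ (forget (ModuleCat.{u} R)) :=
      Limits.PreservesFilteredColimitsOfSize.preserves_filtered_colimits _
    obtain ⟨j, x, hx⟩ := Limits.Concrete.isColimit_exists_rep _ hc h
    obtain ⟨f, hf⟩ := cl_surj (P j.unop.unop) Y i x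
    refine ⟨j.unop.unop, f, ?_⟩
    rw [← hx, ← hf]
    rfl
  · rintro t p rfl f g h
    have := cl_bd (P t) Y p f g h
    change (η t).hom (cl (P t) Y (p+1) f) = 0
    rw [this]
    exact map_zero _
  · intro s t h φ hφ f
    have h1 := cl_nat Y (prj J h) φ hφ i
    have h2 : ((_root_.Ext R (ModuleCat.{u} R) i).map (prj J h).op).app Y ≫ η t = η s := by
      have := Limits.colimit.w D (Quiver.Hom.op (Quiver.Hom.op (homOfLE h)))
      exact congrArg (fun z => NatTrans.app z Y) this
    have h3 : ModuleCat.ofHom (pre Y φ i) ≫ (cl (P t) Y i ≫ η t) = cl (P s) Y i ≫ η s := by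
      rw [← h2, ← Category.assoc, ← h1, Category.assoc]
    exact congrArg (fun z => z.hom f) h3

end

end PF

end Part8

section Part9
open CategoryTheory Opposite
open scoped Pointwise

set_option linter.unusedSectionVars false
set_option linter.unusedVariables false
set_option linter.style.haveILetI false

namespace PF

section

variable {R : Type u} [CommRing R]

/-- Class of a cocycle in `Ext`. -/
noncomputable def em {X : ModuleCat.{u} R} (P : ProjectiveResolution X) (Y : ModuleCat.{u} R)
    (n : ℕ) : cocyc P Y n →ₗ[R] Abelian.Ext X Y n where
  toFun f := P.extMk f.1 (n+1) rfl f.2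
  map_add' f g := (P.add_extMk f.1 g.1 (n+1) rfl f.2 g.2).symm
  map_smul' c f := by
    refine Eq.trans ?_ (Abelian.Ext.smul_eq_comp_mk₀ (P.extMk f.1 (n+1) rfl f.2) c).symm
    refine Eq.trans ?_ (P.extMk_comp_mk₀ f.1 (n+1) rfl f.2 (c • 𝟙 Y)).symm
    congr 1

lemma em_surj {X : ModuleCat.{u} R} (P : ProjectiveResolution X) (Y : ModuleCat.{u} R)
    (n : ℕ) : Function.Surjective (em P Y n) := by
  intro α
  obtain ⟨f, hf, h⟩ := P.extMk_surjective α (n+1) rfl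
  exact ⟨⟨f, hf⟩, h⟩

lemma em_zero {X : ModuleCat.{u} R} (P : ProjectiveResolution X) (Y : ModuleCat.{u} R)
    (p : ℕ) (f : cocyc P Y (p+1)) (h : em P Y (p+1) f = 0) :
    ∃ g : P.complex.X p ⟶ Y, P.complex.d (p+1) p ≫ g = f.1 :=
  (P.extMk_eq_zero_iff f.1 (p+2) rfl f.2 p rfl).1 h

lemma em_pre {X X' : ModuleCat.{u} R} (P : ProjectiveResolution X) (P' : ProjectiveResolution X')
    (Y : ModuleCat.{u} R) (g : X' ⟶ X) (n : ℕ) (f : cocyc P Y n) :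
    em P' Y n (pre Y (ProjectiveResolution.lift g P' P) n f) =
      (Abelian.Ext.mk₀ g).comp (em P Y n f) (zero_add _) := by
  let φ : ProjectiveResolution.Hom P' P g :=
    ⟨ProjectiveResolution.lift g P' P, (ProjectiveResolution.lift_commutes_zero g P' P).trans (by simp)⟩
  exact (ProjectiveResolution.mk₀_comp_extMk f.1 (n+1) rfl f.2 φ).symm

variable [IsLocalRing R] [IsNoetherianRing R]
  {M : Type u} [AddCommGroup M] [Module R M] [Module.Finite R M]

lemma art_of_kill (E : Type u) [AddCommGroup E] [Module R E] [Module.Finite R E] (n : ℕ)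
    (h : ∀ a ∈ maximalIdeal R ^ n, ∀ x : E, a • x = 0) : IsArtinian R E := by
  have htor : Module.IsTorsionBySet R E (maximalIdeal R ^ n : Ideal R) := fun x a => h a a.2 x
  letI := htor.module
  haveI : IsScalarTower R (R ⧸ maximalIdeal R ^ n) E := htor.isScalarTower
  haveI : IsArtinianRing (R ⧸ maximalIdeal R ^ n) := by
    rw [isArtinianRing_iff_krullDimLE_zero, Ring.krullDimLE_zero_iff]
    intro P hP
    have h1 : maximalIdeal R ≤ P.comap (Ideal.Quotient.mk (maximalIdeal R ^ n)) := by
      have hp : (P.comap (Ideal.Quotient.mk (maximalIdeal R ^ n))).IsPrime := inferInstance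
      refine hp.le_of_pow_le (n := n) fun a ha => ?_
      rw [Ideal.mem_comap, Ideal.Quotient.eq_zero_iff_mem.2 ha]
      exact zero_mem _
    have h2 : P.comap (Ideal.Quotient.mk (maximalIdeal R ^ n)) = maximalIdeal R :=
      le_antisymm (le_maximalIdeal (Ideal.IsPrime.ne_top inferInstance)) h1
    have h3 := Ideal.map_eq_top_or_isMaximal_of_surjective
      (Ideal.Quotient.mk (maximalIdeal R ^ n)) Ideal.Quotient.mk_surjective
      (I := P.comap (Ideal.Quotient.mk (maximalIdeal R ^ n)))
      (by rw [h2]; exact maximalIdeal.isMaximal R)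
    rw [Ideal.map_comap_of_surjective _ Ideal.Quotient.mk_surjective] at h3
    exact h3.resolve_left hP.ne_top
  haveI : Module.Finite (R ⧸ maximalIdeal R ^ n) E := Module.Finite.of_restrictScalars_finite R _ _
  exact isArtinian_of_surjective_algebraMap (R := R ⧸ maximalIdeal R ^ n)
    Ideal.Quotient.mk_surjective

lemma hom_factor (N : Type u) [AddCommGroup N] [Module R N] [Module.Finite R N] (J : Ideal R) :
    ∃ n0, ∀ t (h : n0 ≤ t) (f : XJ J t ⟶ ModuleCat.of R N),
      ∃ g : XJ J n0 ⟶ ModuleCat.of R N, f = prj J h ≫ g := by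
  let T : ℕ →o Submodule R N :=
    { toFun := fun t => Submodule.torsionBySet R N (J ^ t : Ideal R)
      monotone' := fun s t h => Submodule.torsionBySet_le_torsionBySet_of_subset
        (Ideal.pow_le_pow_right h) }
  obtain ⟨n0, hn⟩ := monotone_stabilizes_iff_noetherian.2 (inferInstance : IsNoetherian R N) T
  refine ⟨n0, fun t h f => ?_⟩
  have h1 : f.hom 1 ∈ T t := by
    refine (Submodule.mem_torsionBySet_iff _ _).2 fun a => ?_
    have : (a : R) • (1 : R ⧸ J ^ t) = 0 := by
      rw [Algebra.smul_def, mul_one]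
      exact Ideal.Quotient.eq_zero_iff_mem.2 a.2
    rw [← map_smul, this, map_zero]
  rw [← hn t h] at h1
  have h2 := (Submodule.mem_torsionBySet_iff _ _).1 h1
  refine ⟨ModuleCat.ofHom (Submodule.liftQ _ (LinearMap.toSpanSingleton R N (f.hom 1)) ?_), ?_⟩
  · intro a ha
    rw [LinearMap.mem_ker, LinearMap.toSpanSingleton_apply]
    exact h2 ⟨a, ha⟩
  · refine ModuleCat.hom_ext (LinearMap.ext fun x => ?_)
    obtain ⟨x, rfl⟩ := Ideal.Quotient.mk_surjective x
    have e1 : Ideal.Quotient.mk (J ^ t) x = x • (1 : R ⧸ J ^ t) := by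
      rw [Algebra.smul_def, mul_one]; rfl
    change f.hom (Ideal.Quotient.mk (J ^ t) x) = x • f.hom 1
    rw [e1, map_smul]

lemma stab (hZ : Z R M 2) {n : ℕ} (hn : maximalIdeal R ^ n ≤ killIdeal M 2) :
    ∃ n0, ∀ t (h : n0 ≤ t) (ξ : Abelian.Ext (XJ (maximalIdeal R) t) (ModuleCat.of R M) 2),
      ∃ ζ : Abelian.Ext (XJ (maximalIdeal R) n0) (ModuleCat.of R M) 2,
        ξ = (Abelian.Ext.mk₀ (prj (maximalIdeal R) h)).comp ζ (zero_add _) := by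
  obtain ⟨y, hy, hyr⟩ := exists_reg_max (max_not_ass (hZ.mono (by omega : 1 ≤ 2)))
  have q1 := RQ.of_reg (hyr.pow n)
  have hZ1 := Z.quot q1 hZ
  obtain ⟨x, hx, hxr⟩ := exists_reg_max (max_not_ass hZ1)
  have q2 := RQ.of_reg (hxr.pow n)
  obtain ⟨δ1, h1⟩ := exists_conn _ _ q1.inj q1.surj q1.exact
  obtain ⟨δ2, h2⟩ := exists_conn _ _ q2.inj q2.surj q2.exact
  obtain ⟨n0, hn0⟩ := hom_factor (R := R)
    ((M ⧸ (y ^ n • (⊤ : Submodule R M))) ⧸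
      (x ^ n • (⊤ : Submodule R (M ⧸ (y ^ n • (⊤ : Submodule R M)))))) (maximalIdeal R)
  refine ⟨n0, fun t h ξ => ?_⟩
  obtain ⟨η, rfl⟩ := h1 (XJ (maximalIdeal R) t) 1 (hn (Ideal.pow_mem_pow hy n) t) ξ
  have k1 : KE R (R ⧸ maximalIdeal R ^ t) (M ⧸ (y ^ n • (⊤ : Submodule R M))) 1 (x ^ n) := by
    have := KE.right _ _ q1.inj q1.surj q1.exact (hZ 1 (by omega) t)
      (hn (Ideal.pow_mem_pow hx n) t)
    simpa using this
  obtain ⟨η', rfl⟩ := h2 (XJ (maximalIdeal R) t) 0 k1 η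
  obtain ⟨f, rfl⟩ := (Abelian.Ext.mk₀_bijective _ _).2 η'
  obtain ⟨g, rfl⟩ := hn0 t h f
  refine ⟨((Abelian.Ext.mk₀ g).comp δ2 rfl).comp δ1 rfl, ?_⟩
  rw [← Abelian.Ext.mk₀_comp_mk₀]
  rw [Abelian.Ext.comp_assoc_of_second_deg_zero]
  rw [Abelian.Ext.comp_assoc _ _ _ _ _ (by omega)]

lemma genCM_of_kill (hZ : Z R M 2) {n : ℕ} (hn : maximalIdeal R ^ n ≤ killIdeal M 2) :
    IsGenCM R M 3 := by
  set J := maximalIdeal R with hJ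
  let P : ∀ t, ProjectiveResolution (XJ J t) := fun t => projectiveResolution _
  intro i hi
  obtain ⟨θ, hs, hb, hc⟩ := loc_theta J i (ModuleCat.of R M) P
  have key0 : ∀ p, i = p + 1 → ∀ t f, em (P t) (ModuleCat.of R M) i f = 0 → θ t f = 0 := by
    rintro p rfl t f h
    obtain ⟨g, hg⟩ := em_zero _ _ _ f h
    exact hb t p rfl f g hg
  have zcase : (∀ t f, θ t f = 0) →
      IsFiniteLength R ((localCohomology J i).obj (ModuleCat.of R M)) := by
    intro h0
    have : Subsingleton ((localCohomology J i).obj (ModuleCat.of R M)) := by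
      refine subsingleton_of_forall_eq 0 fun z => ?_
      obtain ⟨t, f, rfl⟩ := hs z
      exact h0 t f
    exact IsFiniteLength.of_subsingleton
  match i, hi with
  | 0, _ =>
    apply zcase
    intro t f
    have hf : f = 0 := by
      apply Subtype.ext
      obtain ⟨g, hg⟩ : ∃ g : XJ J t ⟶ ModuleCat.of R M, (P t).π.f 0 ≫ g = f.1 :=
        ⟨_, ((P t).exact₀).g_desc f.1 f.2⟩
      have h0 := KE.zero_iff.1 (hZ 0 (by omega) t) g.hom
      have : g = 0 := by
        refine ModuleCat.hom_ext (LinearMap.ext fun x => ?_)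
        have := h0 x
        rwa [one_smul] at this
      rw [← hg, this]
      exact Limits.comp_zero
    rw [hf, map_zero]
  | 1, _ =>
    apply zcase
    intro t f
    apply key0 0 rfl
    have := hZ 1 (by omega) t (em (P t) (ModuleCat.of R M) 1 f)
    rwa [one_smul] at this
  | 2, _ =>
    obtain ⟨n0, h0⟩ := stab hZ hn
    have hs' : Function.Surjective (θ n0) := by
      intro z
      obtain ⟨s, f, rfl⟩ := hs z
      let t := max s n0
      let φ := ProjectiveResolution.lift (prj J (le_max_left s n0)) (P t) (P s)
      let ψ := ProjectiveResolution.lift (prj J (le_max_right s n0)) (P t) (P n0)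
      obtain ⟨ζ, hζ⟩ := h0 t (le_max_right s n0) (em (P t) (ModuleCat.of R M) 2 (pre _ φ 2 f))
      obtain ⟨g, rfl⟩ := em_surj (P n0) _ _ ζ
      refine ⟨g, ?_⟩
      rw [← em_pre, ← sub_eq_zero, ← map_sub] at hζ
      have h1 := key0 1 rfl t _ hζ
      rw [map_sub, sub_eq_zero,
        hc s t (le_max_left s n0) φ (ProjectiveResolution.lift_commutes_zero _ _ _)] at h1
      rw [h1]
      exact (hc n0 t (le_max_right s n0) ψ (ProjectiveResolution.lift_commutes_zero _ _ _) g).symm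
    let e := em (P n0) (ModuleCat.of R M) 2
    have hker : LinearMap.ker e ≤ LinearMap.ker (θ n0) := fun f hf => key0 1 rfl n0 f hf
    have hfin : Module.Finite R (Abelian.Ext (XJ J n0) (ModuleCat.of R M) 2) := inferInstance
    let q : (cocyc (P n0) (ModuleCat.of R M) 2 ⧸ LinearMap.ker e) →ₗ[R] _ :=
      Submodule.liftQ (LinearMap.ker e) (θ n0) hker
    let eq := (e.quotKerEquivOfSurjective (em_surj _ _ _)).symm
    have hq : Function.Surjective (q ∘ₗ eq.toLinearMap) := by
      intro z
      obtain ⟨f, rfl⟩ := hs' z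
      refine ⟨eq.symm (Submodule.mkQ _ f), ?_⟩
      rw [LinearMap.comp_apply, LinearEquiv.coe_coe, LinearEquiv.apply_symm_apply]
      rfl
    refine IsFiniteLength.of_surjective ?_ hq
    rw [isFiniteLength_iff_isNoetherian_isArtinian]
    refine ⟨inferInstance, ?_⟩
    exact art_of_kill _ n fun a ha ξ => hn ha n0 ξ

theorem thmII (hCM : IsQuotientOfCMLocalRing R)
    (hD : mdim R M = 3) (hU : IsUnmixed R M) (hZ : Z R M 2)
    (hS : ∀ Q q0 q1 : Ideal R, Q.IsPrime → q0.IsPrime → q1.IsPrime → q0 < q1 → q1 < Q →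
      Module.annihilator R M ≤ q0 → ∀ y ∈ Q, IsSMulRegular M y →
      Q ∉ associatedPrimes R (QuotSMulTop y M)) : IsGenCM R M 3 := by
  obtain ⟨n, hn⟩ := kill2_final hCM hD hU hZ hS
  exact genCM_of_kill hZ hn

end

end PF

end Part9

section Part10
open scoped Pointwise

set_option linter.unusedSectionVars false
set_option linter.unusedVariables false
set_option linter.style.haveILetI false

namespace PF

section

lemma not_zero_dim {A : Type u} [CommRing A] {I : Ideal A} (h : ¬ ringKrullDim (A ⧸ I) ≤ 0) :
    ∃ q0 q1 : Ideal A, q0.IsPrime ∧ q1.IsPrime ∧ I ≤ q0 ∧ q0 < q1 := by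
  rw [not_le, ringKrullDim_quotient, Order.krullDim_pos_iff] at h
  obtain ⟨x, y, hxy⟩ := h
  exact ⟨x.1.asIdeal, y.1.asIdeal, x.1.2, y.1.2, x.2, hxy⟩

lemma not_one_dim {A : Type u} [CommRing A] {I : Ideal A} (h : ¬ ringKrullDim (A ⧸ I) ≤ 1) :
    ∃ q0 q1 q2 : Ideal A, q0.IsPrime ∧ q1.IsPrime ∧ q2.IsPrime ∧ I ≤ q0 ∧ q0 < q1 ∧ q1 < q2 := by
  rw [not_le, ringKrullDim_quotient] at h
  have h2 : ((2 : ℕ) : WithBot ℕ∞) ≤ Order.krullDim (PrimeSpectrum.zeroLocus (R := A) I) := by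
    have := ENat.WithBot.add_one_le_iff (n := 1) |>.2 h
    exact this
  obtain ⟨l, hl⟩ := Order.le_krullDim_iff.1 h2
  refine ⟨(l ⟨0, by omega⟩).1.asIdeal, (l ⟨1, by omega⟩).1.asIdeal, (l ⟨2, by omega⟩).1.asIdeal,
    (l _).1.2, (l _).1.2, (l _).1.2, (l _).2, ?_, ?_⟩
  · exact l.strictMono (Fin.mk_lt_mk.2 (by omega))
  · exact l.strictMono (Fin.mk_lt_mk.2 (by omega))

variable {R : Type u} [CommRing R] [IsLocalRing R] [IsNoetherianRing R]
  {N : Type u} [AddCommGroup N] [Module R N]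

lemma max_ass {x : N} (hx : x ≠ 0) (h : ∀ a ∈ maximalIdeal R, a • x = 0) :
    maximalIdeal R ∈ associatedPrimes R N := by
  refine ass_iff.2 ⟨inferInstance, x, fun a => ⟨h a, fun ha => ?_⟩⟩
  by_contra hm
  have hu : IsUnit a := by
    by_contra hu
    exact hm ((mem_maximalIdeal a).2 hu)
  exact hx (hu.smul_eq_zero.1 ha)

variable [Module.Finite R N]

lemma one_le_depth [Nontrivial N] (h : maximalIdeal R ∉ associatedPrimes R N) :
    1 ≤ depth R N := by
  obtain ⟨x, hx, hr⟩ := exists_reg_max h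
  refine le_sSup ⟨[x], by simp, by simpa using hx, ?_⟩
  refine (IsLocalRing.isRegular_iff_isWeaklyRegular_of_subset_maximalIdeal
    (by simpa using hx)).2 ?_
  rw [RingTheory.Sequence.isWeaklyRegular_cons_iff]
  exact ⟨hr, RingTheory.Sequence.IsWeaklyRegular.nil _ _⟩

lemma depth_le_dim [Nontrivial N] : (depth R N : WithBot (WithTop ℕ)) ≤ mdim R N := by
  have hne : Module.annihilator R N ≠ ⊤ := by
    intro h
    obtain ⟨x, hx⟩ := exists_ne (0 : N)
    apply hx
    have : (1 : R) ∈ Module.annihilator R N := h ▸ Submodule.mem_top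
    simpa using Module.mem_annihilator.1 this x
  obtain ⟨n, hn⟩ := exists_dim hne
  have e : mdim R N = ((n : WithTop ℕ) : WithBot (WithTop ℕ)) := hn
  rw [e, WithBot.coe_le_coe]
  refine sSup_le ?_
  rintro _ ⟨rs, rfl, hm, hr⟩
  have h1 := Module.supportDim_add_length_eq_supportDim_of_isRegular rs hr
  rw [Module.supportDim_eq_ringKrullDim_quotient_annihilator (R := R) (M := N), hn] at h1
  have hnt : Nontrivial (N ⧸ Ideal.ofList rs • (⊤ : Submodule R N)) :=
    Submodule.Quotient.nontrivial_iff.2 hr.top_ne_smul.symm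
  have h2 := Module.supportDim_ne_bot_of_nontrivial (R := R)
    (M := N ⧸ Ideal.ofList rs • (⊤ : Submodule R N))
  have h3 : (0 : WithBot ℕ∞) ≤ Module.supportDim R (N ⧸ Ideal.ofList rs • (⊤ : Submodule R N)) := by
    obtain ⟨k, hk⟩ := WithBot.ne_bot_iff_exists.1 h2
    rw [← hk]
    exact WithBot.coe_le_coe.2 (bot_le : (0 : ℕ∞) ≤ k)
  have h4 : ((rs.length : ℕ) : WithBot ℕ∞) ≤ ((n : ℕ) : WithBot ℕ∞) := by
    rw [← h1]
    exact le_add_of_nonneg_left h3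
  have h5 : rs.length ≤ n := by exact_mod_cast h4
  exact_mod_cast h5

/-- Local dimension at most one plus chain condition. -/
lemma depth_core {B : Type u} [CommRing B] [IsLocalRing B] [IsNoetherianRing B]
    {L : Type u} [AddCommGroup L] [Module B L] [Module.Finite B L] [Nontrivial L]
    (hum : IsUnmixed R N) (hdim : mdim R N = 3) (c : Ideal B → Ideal R)
    {p p1 p2 : Ideal R} [p.IsPrime] [p1.IsPrime] [p2.IsPrime] (h1 : p < p1) (h2 : p1 < p2)
    (cp : ∀ q : Ideal B, q.IsPrime → (c q).IsPrime)
    (clt : ∀ q q' : Ideal B, q < q' → c q < c q')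
    (cle : ∀ q : Ideal B, q.IsPrime → c q ≤ p)
    (cann : ∀ q : Ideal B, Module.annihilator B L ≤ q → Module.annihilator R N ≤ c q)
    (cass : maximalIdeal B ∈ associatedPrimes B L → c (maximalIdeal B) ∈ associatedPrimes R N) :
    min 2 (mdim B L) ≤ (depth B L : WithBot (WithTop ℕ)) := by
  have hbd : ∀ q : Ideal B, Module.annihilator B L ≤ q → ringKrullDim (R ⧸ c q) ≤ 3 := by
    intro q hq
    exact (dim_mono (cann q hq)).trans (le_of_eq hdim)
  by_cases hm : maximalIdeal B ∈ associatedPrimes B L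
  · have h0 : mdim B L ≤ 0 := by
      by_contra hcon
      obtain ⟨q0, q1, hq0, hq1, ha, hlt⟩ := not_zero_dim hcon
      have hlt' : q0 < maximalIdeal B := hlt.trans_le (le_maximalIdeal hq1.ne_top)
      have := cp q0 hq0
      have := cp (maximalIdeal B) inferInstance
      have h3 := dim_step (clt _ _ hlt')
      rw [hum _ (cass hm), hdim] at h3
      have h4 := h3.trans (hbd q0 ha)
      have h5 : ((3 + 1 : ℕ) : WithBot ℕ∞) ≤ ((3 : ℕ) : WithBot ℕ∞) := h4
      exact absurd (by exact_mod_cast h5 : 3 + 1 ≤ 3) (by omega)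
    refine (min_le_right _ _).trans (h0.trans ?_)
    exact WithBot.coe_le_coe.2 (bot_le : (0 : WithTop ℕ) ≤ depth B L)
  · have hd1 : mdim B L ≤ 1 := by
      by_contra hcon
      obtain ⟨q0, q1, q2, hq0, hq1, hq2, ha, hlt, hlt'⟩ := not_one_dim hcon
      have := cp q0 hq0
      have := cp q1 hq1
      have := cp q2 hq2
      have e1 := dim_step (clt _ _ hlt)
      have e2 := dim_step (clt _ _ hlt')
      have e3 := dim_mono (cle q2 hq2)
      have e4 := two_le_dim (le_refl p) h1 h2
      have : (2 : WithBot ℕ∞) + 1 + 1 ≤ 3 :=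
        calc (2 : WithBot ℕ∞) + 1 + 1 ≤ ringKrullDim (R ⧸ c q2) + 1 + 1 := by
              gcongr; exact e4.trans e3
          _ ≤ ringKrullDim (R ⧸ c q1) + 1 := by gcongr
          _ ≤ _ := e1
          _ ≤ 3 := hbd q0 ha
      have h5 : ((2 + 1 + 1 : ℕ) : WithBot ℕ∞) ≤ ((3 : ℕ) : WithBot ℕ∞) := this
      exact absurd (by exact_mod_cast h5 : 2 + 1 + 1 ≤ 3) (by omega)
    refine (min_le_right _ _).trans (hd1.trans ?_)
    exact WithBot.coe_le_coe.2 (one_le_depth hm)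

lemma s2_of_chain (hum : IsUnmixed R N) (hdim : mdim R N = 3)
    {p p1 p2 : Ideal R} [p.IsPrime] [p1.IsPrime] [p2.IsPrime] (h1 : p < p1) (h2 : p1 < p2) :
    IsS2 (Localization.AtPrime p) (LocalizedModule p.primeCompl N) := by
  intro P hP
  have hnt : Nontrivial (LocalizedModule P.asIdeal.primeCompl (LocalizedModule p.primeCompl N)) := hP
  let c1 : Ideal (Localization.AtPrime P.asIdeal) → Ideal (Localization.AtPrime p) :=
    fun q => q.comap (algebraMap _ _)
  let c2 : Ideal (Localization.AtPrime p) → Ideal R := fun q => q.comap (algebraMap _ _)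
  have lt1 : ∀ q q', q < q' → c1 q < c1 q' := fun q q' h =>
    (IsLocalization.orderEmbedding P.asIdeal.primeCompl (Localization.AtPrime P.asIdeal)).lt_iff_lt.2 h
  have lt2 : ∀ q q', q < q' → c2 q < c2 q' := fun q q' h =>
    (IsLocalization.orderEmbedding p.primeCompl (Localization.AtPrime p)).lt_iff_lt.2 h
  refine depth_core hum hdim (fun q => c2 (c1 q)) h1 h2 ?_ ?_ ?_ ?_ ?_
  · intro q hq
    have : (c1 q).IsPrime := Ideal.comap_isPrime _ _
    exact Ideal.comap_isPrime _ _
  · intro q q' h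
    exact lt2 _ _ (lt1 _ _ h)
  · intro q hq
    have : (c1 q).IsPrime := Ideal.comap_isPrime _ _
    have h3 : c1 q ≤ maximalIdeal _ := le_maximalIdeal this.ne_top
    refine (Ideal.comap_mono h3).trans ?_
    exact le_of_eq (IsLocalization.AtPrime.under_maximalIdeal (Localization.AtPrime p) p)
  · intro q hq r hr
    refine hq ?_
    rw [Module.mem_annihilator] at hr ⊢
    intro z
    induction z using LocalizedModule.induction_on with
    | h z s =>
      rw [algebraMap_smul, LocalizedModule.smul'_mk]
      have : (algebraMap R (Localization.AtPrime p)) r • z = 0 := by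
        induction z using LocalizedModule.induction_on with
        | h z s =>
          rw [algebraMap_smul, LocalizedModule.smul'_mk, hr, LocalizedModule.zero_mk]
      rw [this, LocalizedModule.zero_mk]
  · intro h
    have h3 := Module.associatedPrimes.comap_mem_associatedPrimes_of_mem_associatedPrimes_of_isLocalizedModule_of_fg
      P.asIdeal.primeCompl
      (LocalizedModule.mkLinearMap P.asIdeal.primeCompl (LocalizedModule p.primeCompl N)) _ h
      (IsNoetherian.noetherian _)
    exact Module.associatedPrimes.comap_mem_associatedPrimes_of_mem_associatedPrimes_of_isLocalizedModule_of_fg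
      p.primeCompl (LocalizedModule.mkLinearMap p.primeCompl N) _ h3 (IsNoetherian.noetherian _)

end

section

variable {R : Type u} [CommRing R] [IsLocalRing R] [IsNoetherianRing R]
  {M : Type u} [AddCommGroup M] [Module R M] [Module.Finite R M]
  {S : Type u} [AddCommGroup S] [Module R S]

lemma max_not_ass_quot (ι : M →ₗ[R] S) (hι : Function.Injective ι) (hZ : Z R M 2)
    (hm : maximalIdeal R ∉ associatedPrimes R S) :
    maximalIdeal R ∉ associatedPrimes R (S ⧸ LinearMap.range ι) := by
  intro hass
  obtain ⟨-, z, hz⟩ := ass_iff.1 hass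
  obtain ⟨z, rfl⟩ := Submodule.mkQ_surjective _ z
  obtain ⟨y, hy, hyr⟩ := exists_reg_max (max_not_ass (hZ.mono (by omega : 1 ≤ 2)))
  have q1 := RQ.of_reg hyr
  have hZ1 := max_not_ass (Z.quot q1 hZ)
  have hw : ∀ a ∈ maximalIdeal R, ∃ w, ι w = a • z := by
    intro a ha
    have := (hz a).1 ha
    rw [← map_smul] at this
    exact (Submodule.Quotient.mk_eq_zero _).1 this
  obtain ⟨w, hyw⟩ := hw y hy
  have hw1 : (y • (⊤ : Submodule R M)).mkQ w = 0 := by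
    by_contra hne
    refine hZ1 (max_ass hne fun a ha => ?_)
    obtain ⟨v, hv⟩ := hw a ha
    have : a • w = y • v := by
      apply hι
      rw [map_smul, map_smul, hyw, hv, smul_comm]
    rw [← map_smul, this]
    exact (q1.exact _).2 ⟨v, rfl⟩
  obtain ⟨v, hv⟩ := (q1.exact _).1 hw1
  have hv' : y • v = w := hv
  have h0 : z - ι v = 0 := by
    by_contra hne
    refine hm (max_ass hne fun a ha => ?_)
    obtain ⟨u, hu⟩ := hw a ha
    have : u = a • v := by
      apply hyr
      change y • u = y • a • v
      apply hι
      rw [smul_comm y a v, hv', map_smul, map_smul, hyw, hu, smul_comm]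
    rw [smul_sub, ← hu, this, map_smul, sub_self]
  have hz0 : (LinearMap.range ι).mkQ z = 0 :=
    (Submodule.Quotient.mk_eq_zero _).2 ⟨v, (sub_eq_zero.1 h0).symm⟩
  have : (1 : R) ∈ maximalIdeal R := (hz 1).2 (by rw [hz0, smul_zero])
  exact (Ideal.ne_top_iff_one _).1 (Ideal.IsPrime.ne_top inferInstance) this

lemma dim_quot_le (hum : IsUnmixed R M) (hdim : mdim R M = 3) (ι : M →ₗ[R] S)
    (hS : IsS2ification R M S ι) : mdim R (S ⧸ LinearMap.range ι) ≤ 1 := by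
  obtain ⟨hι, hfin, hS2, hloc⟩ := hS
  by_contra hcon
  obtain ⟨p, p1, p2, hp, hp1, hp2, ha, h1, h2⟩ := not_one_dim hcon
  have hpm : p ≠ maximalIdeal R := by
    rintro rfl
    exact absurd (le_maximalIdeal hp1.ne_top) (not_le_of_gt h1)
  have hsurj := hloc p hpm (s2_of_chain hum hdim h1 h2)
  have hsupp : (⟨p, hp⟩ : PrimeSpectrum R) ∈ Module.support R (S ⧸ LinearMap.range ι) := by
    rw [Module.support_eq_zeroLocus]; exact ha
  refine (Module.notMem_support_iff'.2 fun z => ?_) hsupp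
  obtain ⟨z, rfl⟩ := Submodule.mkQ_surjective _ z
  obtain ⟨x, hx⟩ := hsurj (LocalizedModule.mkLinearMap p.primeCompl S z)
  induction x using LocalizedModule.induction_on with
  | h m s =>
    have e1 : IsLocalizedModule.map p.primeCompl
        (LocalizedModule.mkLinearMap p.primeCompl M)
        (LocalizedModule.mkLinearMap p.primeCompl S) ι (LocalizedModule.mk m s) =
        LocalizedModule.mk (ι m) s := by
      rw [IsLocalizedModule.mk_eq_mk', IsLocalizedModule.map_mk', ← IsLocalizedModule.mk_eq_mk']
    rw [e1, LocalizedModule.mkLinearMap_apply, LocalizedModule.mk_eq] at hx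
    obtain ⟨c, hc⟩ := hx
    refine ⟨(c : R) * s, ?_, ?_⟩
    · intro h
      rcases hp.mem_or_mem h with h | h
      · exact c.2 h
      · exact s.2 h
    · rw [← map_smul]
      refine (Submodule.Quotient.mk_eq_zero _).2 ⟨(c : R) • m, ?_⟩
      rw [map_smul, mul_smul]
      simpa [Submonoid.smul_def] using hc

lemma final (hCM : IsQuotientOfCMLocalRing R)
    (hum : IsUnmixed R M) (hdim : mdim R M = 3) (hdepth : depth R M = 2)
    (hngcm : ¬ IsGenCM R M 3)
    (ι : M →ₗ[R] S) (hS : IsS2ification R M S ι) :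
    IsCM R (S ⧸ LinearMap.range ι) ∧ mdim R (S ⧸ LinearMap.range ι) = 1 := by
  have hle := dim_quot_le hum hdim ι hS
  obtain ⟨hι, hfin, hS2, hloc⟩ := hS
  have hZ : Z R M 2 := depth_Z (n := 1) (by rw [hdepth]; exact_mod_cast Nat.one_lt_two)
  have hann : Module.annihilator R S ≤ Module.annihilator R M :=
    LinearMap.annihilator_le_of_injective ι hι
  have hmS : maximalIdeal R ∉ associatedPrimes R S := by
    have h0 : ¬ mdim R M ≤ 0 := by rw [hdim]; exact_mod_cast (by decide : ¬ (3 : ℕ) ≤ 0)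
    obtain ⟨q0, q1, hq0, hq1, ha, hlt⟩ := not_zero_dim h0
    exact s2_ass hS2 (hlt.trans_le (le_maximalIdeal hq1.ne_top)) (hann.trans ha)
  have hmD := max_not_ass_quot ι hι hZ hmS
  have hnt : Nontrivial (S ⧸ LinearMap.range ι) := by
    refine Submodule.Quotient.nontrivial_iff.2 fun htop => hngcm ?_
    let e : M ≃ₗ[R] S := LinearEquiv.ofBijective ι ⟨hι, LinearMap.range_eq_top.1 htop⟩
    refine thmII hCM hdim hum hZ ?_
    intro Q q0 q1 hQ hq0 hq1 h01 h1Q ha y hy hyr hass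
    rw [LinearEquiv.AssociatedPrimes.eq (QuotSMulTop.congr y e)] at hass
    exact s2_quot hS2 h01 h1Q (hann.trans ha) ((e.isSMulRegular_congr y).1 hyr) hass
  have h1 : (1 : WithBot (WithTop ℕ)) ≤ (depth R (S ⧸ LinearMap.range ι) : WithBot (WithTop ℕ)) :=
    WithBot.coe_le_coe.2 (one_le_depth hmD)
  have h2 := depth_le_dim (R := R) (N := S ⧸ LinearMap.range ι)
  exact ⟨le_antisymm h2 (hle.trans h1), le_antisymm hle (h1.trans h2)⟩

end

end PF

end Part10

/-- If `M` is unmixed of dimension 3 and depth 2 and not generalized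
Cohen-Macaulay, and `S` is an `S_2`-ification of `M`, then `D = S/M` is a Cohen-Macaulay
module of dimension 1. -/
theorem stmt13 (R : Type u) [CommRing R] [IsLocalRing R] [IsNoetherianRing R]
    (hCM : IsQuotientOfCMLocalRing R)
    (M : Type u) [AddCommGroup M] [Module R M] [Module.Finite R M]
    (hum : IsUnmixed R M) (hdim : mdim R M = 3) (hdepth : depth R M = 2)
    (hngcm : ¬ IsGenCM R M 3)
    (S : Type u) [AddCommGroup S] [Module R S]
    (ι : M →ₗ[R] S) (hS : IsS2ification R M S ι) :
    IsCM R (S ⧸ LinearMap.range ι) ∧ mdim R (S ⧸ LinearMap.range ι) = 1 := by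
  exact PF.final hCM hum hdim hdepth hngcm ι hS
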